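/- Let X be a 7-vertex 3-dimensional simplicial complex such that X is Z₂-acyclic, X is not collapsible, and X is minimal with these properties (no proper subcomplex of X is both Z₂-acyclic and non-collapsible). Then the f-vector (f₀,f₁,f₂,f₃) of X is one of (7,20,30,16), (7,21,32,17), (7,21,33,18), (7,21,34,19), (7,21,35,20). -/

import Mathlib

/- Formalization of definitions from:
   B. Bagchi, B. Datta, "Combinatorial triangulations of homology spheres". -/

open Finset

noncomputable section

attribute [local instance] Classical.propDecidable

namespace HomologySpheres

variable {V : Type*} [DecidableEq V] {W : Type*} [DecidableEq W]

/-- The vertex set of a finite family of finite sets. -/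
def verts (K : Finset (Finset V)) : Finset V := K.sup id

/-- An (abstract, finite) simplicial complex: a nonempty collection of nonempty
finite sets closed under taking nonempty subsets. -/
def IsComplex (K : Finset (Finset V)) : Prop :=
  K.Nonempty ∧ ∅ ∉ K ∧ ∀ s ∈ K, ∀ t : Finset V, t ⊆ s → t.Nonempty → t ∈ K

/-- The facets (maximal faces) of `K`. -/
def facets (K : Finset (Finset V)) : Finset (Finset V) :=
  K.filter fun s => ∀ t ∈ K, s ⊆ t → t = s

/-- `K` is pure of dimension `d`: every maximal face has `d + 1` vertices. -/
def IsPure (d : ℕ) (K : Finset (Finset V)) : Prop :=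
  ∀ s ∈ facets K, s.card = d + 1

/-- The link of a face `σ` in `K`. -/
def link (K : Finset (Finset V)) (σ : Finset V) : Finset (Finset V) :=
  K.filter fun τ => Disjoint τ σ ∧ τ ∪ σ ∈ K

/-- `L` is an induced (full) subcomplex of `K`. -/
def IsInduced (K L : Finset (Finset V)) : Prop :=
  L ⊆ K ∧ ∀ s ∈ K, s ⊆ verts L → s ∈ L

/-- The simplicial complement `C(L, K)`: the induced subcomplex of `K` on
`V(K) \ V(L)`. -/
def simpComplement (L K : Finset (Finset V)) : Finset (Finset V) :=
  K.filter fun s => s ⊆ verts K \ verts L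

/-- The simplicial neighbourhood `N(L, K)`: the subcomplex of `K` whose maximal
faces are the maximal faces of `K` meeting `V(L)`. -/
def simpNbhd (L K : Finset (Finset V)) : Finset (Finset V) :=
  K.filter fun s => ∃ t ∈ facets K, s ⊆ t ∧ (t ∩ verts L).Nonempty

/-- `fvec K i` is the number of `i`-dimensional faces of `K`. -/
def fvec (K : Finset (Finset V)) (i : ℕ) : ℕ :=
  (K.filter fun s => s.card = i + 1).card

/-- The number of facets of cardinality `d + 1` containing a given `(d-1)`-face
(the degree of the face in a (weak) pseudomanifold of dimension `d`). -/
def degOf (K : Finset (Finset V)) (d : ℕ) (s : Finset V) : ℕ :=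
  (K.filter fun t => s ⊆ t ∧ t.card = d + 1).card

/-- Simplicial isomorphism (via a vertex bijection carrying faces to faces). -/
def Iso (K : Finset (Finset V)) (L : Finset (Finset W)) : Prop :=
  ∃ f : V → W, Set.InjOn f ↑(verts K) ∧ L = K.image (Finset.image f)

/-- The join of two simplicial complexes (on disjoint vertex sets). -/
def sjoin (K L : Finset (Finset V)) : Finset (Finset V) :=
  K ∪ L ∪ (K ×ˢ L).image fun p => p.1 ∪ p.2

/-- The standard ball on vertex set `A`: all nonempty subsets of `A`. -/
def stdBall (A : Finset V) : Finset (Finset V) := A.powerset.erase ∅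

/-- The standard sphere on vertex set `A`: all nonempty proper subsets of `A`. -/
def stdSphere (A : Finset V) : Finset (Finset V) := (A.powerset.erase ∅).erase A

/-- `τ` is a free face of `K`, with `σ` the unique face properly containing it. -/
def IsFreeFace (K : Finset (Finset V)) (τ σ : Finset V) : Prop :=
  τ ∈ K ∧ σ ∈ K ∧ τ ⊂ σ ∧ ∀ ρ ∈ K, τ ⊂ ρ → ρ = σ

/-- An elementary collapse removes a free face together with the unique face
properly containing it. -/
def ElemCollapse (K K' : Finset (Finset V)) : Prop :=
  ∃ τ σ : Finset V, IsFreeFace K τ σ ∧ K' = (K.erase τ).erase σ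

/-- `K` collapses to `L` by a sequence of elementary collapses. -/
def CollapsesTo (K L : Finset (Finset V)) : Prop :=
  Relation.ReflTransGen ElemCollapse K L

/-- `K` is collapsible: it collapses to a single vertex. -/
def Collapsible (K : Finset (Finset V)) : Prop :=
  ∃ v : V, CollapsesTo K {{v}}

/-! ### Simplicial homology with `ℤ/2` coefficients (augmented chain complex).
A chain of level `n` is a `ZMod 2`-valued function supported on the faces of
cardinality `n` (the empty set, of cardinality `0`, serves as the `(-1)`-simplex
of the augmented complex).  Reduced homology in dimension `q` lives at level
`q + 1`. -/

/-- `c` is a chain of level `n` of `K` (over `ℤ/2`). -/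
def z2chainOK (K : Finset (Finset V)) (n : ℕ) (c : Finset V → ZMod 2) : Prop :=
  ∀ s : Finset V, c s ≠ 0 → s.card = n ∧ (s ∈ K ∨ s = ∅)

/-- The mod-2 boundary operator. -/
def z2bdry (K : Finset (Finset V)) (c : Finset V → ZMod 2) : Finset V → ZMod 2 :=
  fun t => ∑ v ∈ verts K \ t, c (insert v t)

/-- `K` is `ℤ/2`-acyclic: all reduced homology with `ℤ/2` coefficients vanishes,
i.e. in the augmented mod-2 chain complex every cycle is a boundary. -/
def Z2Acyclic (K : Finset (Finset V)) : Prop :=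
  ∀ (n : ℕ) (c : Finset V → ZMod 2), z2chainOK K n c → z2bdry K c = 0 →
    ∃ c', z2chainOK K (n + 1) c' ∧ z2bdry K c' = c

/-- `K` has the reduced `ℤ/2`-homology of the `d`-sphere: reduced homology
vanishes in all dimensions except `d` (level `d + 1`), where it is `ℤ/2`
(there is a cycle `z` which is not a boundary, and modulo boundaries every
cycle is `0` or `z`). -/
def Z2HomologySphere (d : ℕ) (K : Finset (Finset V)) : Prop :=
  (∀ (n : ℕ) (c : Finset V → ZMod 2), n ≠ d + 1 → z2chainOK K n c →
    z2bdry K c = 0 → ∃ c', z2chainOK K (n + 1) c' ∧ z2bdry K c' = c) ∧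
  (∃ z : Finset V → ZMod 2, z2chainOK K (d + 1) z ∧ z2bdry K z = 0 ∧
    (∀ c', z2chainOK K (d + 2) c' → z2bdry K c' ≠ z) ∧
    (∀ z', z2chainOK K (d + 1) z' → z2bdry K z' = 0 →
      (∃ c', z2chainOK K (d + 2) c' ∧ z2bdry K c' = z') ∨
      (∃ c', z2chainOK K (d + 2) c' ∧ z2bdry K c' = z + z')))

/-! ### Integral simplicial homology via ordered chains (Munkres §13: ordered
simplicial homology, allowing repeated vertices, agrees with simplicial
homology). An ordered `m`-tuple chain corresponds to dimension `m - 1`; the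
unique `0`-tuple is the `(-1)`-simplex of the augmented complex. -/

/-- `c` is an ordered chain of `K` over `ℤ`: supported on tuples whose image is
a face (the empty tuple being allowed in level `0`). -/
def zchainOK (K : Finset (Finset V)) {m : ℕ} (c : (Fin m → V) → ℤ) : Prop :=
  ∀ x : Fin m → V, c x ≠ 0 → (Finset.univ.image x ∈ K ∨ m = 0)

/-- The integral boundary operator on ordered chains. -/
def zbdry (K : Finset (Finset V)) {m : ℕ} (c : (Fin (m + 1) → V) → ℤ) :
    (Fin m → V) → ℤ :=
  fun y => ∑ i : Fin (m + 1), (-1 : ℤ) ^ (i : ℕ) * ∑ v ∈ verts K, c (i.insertNth v y)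

/-- `K` has the reduced integral homology of the `d`-sphere: reduced homology
vanishes in all dimensions except `d`, where it is infinite cyclic (there is a
cycle `z` such that every cycle is, modulo boundaries, a unique multiple of `z`). -/
def ZHomologySphere (d : ℕ) (K : Finset (Finset V)) : Prop :=
  (∀ c : (Fin 0 → V) → ℤ, ∃ c' : (Fin 1 → V) → ℤ, zchainOK K c' ∧ zbdry K c' = c) ∧
  (∀ (m : ℕ) (c : (Fin (m + 1) → V) → ℤ), m ≠ d → zchainOK K c → zbdry K c = 0 →
    ∃ c' : (Fin (m + 2) → V) → ℤ, zchainOK K c' ∧ zbdry K c' = c) ∧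
  (∃ z : (Fin (d + 1) → V) → ℤ, zchainOK K z ∧ zbdry K z = 0 ∧
    ∀ z' : (Fin (d + 1) → V) → ℤ, zchainOK K z' → zbdry K z' = 0 →
      ∃! k : ℤ, ∃ c'' : (Fin (d + 2) → V) → ℤ,
        zchainOK K c'' ∧ zbdry K c'' = z' - k • z)

/-- A weak pseudomanifold of dimension `d`: pure, and every `(d-1)`-face is in
exactly two facets. -/
def IsWeakPseudomanifold (d : ℕ) (K : Finset (Finset V)) : Prop :=
  IsComplex K ∧ IsPure d K ∧ ∀ s ∈ K, s.card = d → degOf K d s = 2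

/-- Adjacency of facets along a common `(d-1)`-face. -/
def FacetAdj (d : ℕ) (K : Finset (Finset V)) (s t : Finset V) : Prop :=
  s ∈ K ∧ t ∈ K ∧ s.card = d + 1 ∧ t.card = d + 1 ∧ (s ∩ t).card = d

/-- A pseudomanifold: a weak pseudomanifold in which any two facets are joined
by a chain of facets, consecutive ones sharing a `(d-1)`-face. -/
def IsPseudomanifold (d : ℕ) (K : Finset (Finset V)) : Prop :=
  IsWeakPseudomanifold d K ∧ ∀ s ∈ K, ∀ t ∈ K, s.card = d + 1 → t.card = d + 1 →
    Relation.ReflTransGen (FacetAdj d K) s t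

/-- A weak pseudomanifold with boundary. -/
def IsWeakPseudomanifoldWithBdry (d : ℕ) (K : Finset (Finset V)) : Prop :=
  IsComplex K ∧ IsPure d K ∧
  (∀ s ∈ K, s.card = d → degOf K d s = 1 ∨ degOf K d s = 2) ∧
  (∃ s ∈ K, s.card = d ∧ degOf K d s = 1)

/-- The boundary complex: all faces of degree-one `(d-1)`-faces. -/
def bdryComplex (d : ℕ) (K : Finset (Finset V)) : Finset (Finset V) :=
  K.filter fun t => ∃ s ∈ K, t ⊆ s ∧ s.card = d ∧ degOf K d s = 1

/-- `K` is connected (any two vertices joined by a path of edges). -/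
def SConnected (K : Finset (Finset V)) : Prop :=
  ∀ u ∈ verts K, ∀ v ∈ verts K,
    Relation.ReflTransGen (fun a b : V => ({a, b} : Finset V) ∈ K) u v

/-! ### Geometric realizations, subdivisions and combinatorial equivalence. -/

/-- A geometric simplicial complex in `ℝ^ℕ`: finitely many geometric simplices
(affinely independent vertex sets), closed under faces, any two of which meet
in a common face. -/
structure GComplex where
  faces : Finset (Finset (ℕ → ℝ))
  nonempty : faces.Nonempty
  empty_not_mem : ∅ ∉ faces
  down_closed : ∀ s ∈ faces, ∀ t : Finset (ℕ → ℝ), t ⊆ s → t.Nonempty → t ∈ faces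
  indep : ∀ s ∈ faces,
    AffineIndependent ℝ (fun x : {y : ℕ → ℝ // y ∈ s} => (x : ℕ → ℝ))
  glue : ∀ s ∈ faces, ∀ t ∈ faces,
    convexHull ℝ (s : Set (ℕ → ℝ)) ∩ convexHull ℝ (t : Set (ℕ → ℝ)) =
      convexHull ℝ ((s ∩ t : Finset (ℕ → ℝ)) : Set (ℕ → ℝ))

/-- The geometric carrier (underlying polyhedron) of a geometric complex. -/
def GComplex.carrier (G : GComplex) : Set (ℕ → ℝ) :=
  ⋃ s ∈ G.faces, convexHull ℝ (s : Set (ℕ → ℝ))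

/-- `G` realizes the abstract complex `K` via the vertex map `f`. -/
def RealizesMap (G : GComplex) (K : Finset (Finset V)) (f : V → ℕ → ℝ) : Prop :=
  Set.InjOn f ↑(verts K) ∧ G.faces = K.image (Finset.image f)

/-- `G` is a geometric realization of the abstract complex `K`. -/
def Realizes (G : GComplex) (K : Finset (Finset V)) : Prop :=
  ∃ f : V → ℕ → ℝ, RealizesMap G K f

/-- `G'` is a subdivision of `G`: same carrier, and every simplex of `G'` is
contained in a simplex of `G`. -/
def Subdivides (G' G : GComplex) : Prop :=
  G'.carrier = G.carrier ∧
  ∀ s ∈ G'.faces, ∃ t ∈ G.faces,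
    convexHull ℝ (s : Set (ℕ → ℝ)) ⊆ convexHull ℝ (t : Set (ℕ → ℝ))

/-- Combinatorial equivalence: `K` and `L` admit isomorphic subdivisions. -/
def CombEquiv (K : Finset (Finset V)) (L : Finset (Finset W)) : Prop :=
  ∃ G1 G1' G2 G2' : GComplex, Realizes G1 K ∧ Realizes G2 L ∧
    Subdivides G1' G1 ∧ Subdivides G2' G2 ∧ Iso G1'.faces G2'.faces

/-- A combinatorial `d`-ball: combinatorially equivalent to the standard ball. -/
def IsCombBall (d : ℕ) (K : Finset (Finset V)) : Prop :=
  ∃ A : Finset ℕ, A.card = d + 1 ∧ CombEquiv K (stdBall A)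

/-- A combinatorial `d`-sphere: combinatorially equivalent to the standard sphere. -/
def IsCombSphere (d : ℕ) (K : Finset (Finset V)) : Prop :=
  ∃ A : Finset ℕ, A.card = d + 2 ∧ CombEquiv K (stdSphere A)

/-- A combinatorial `d`-manifold: every vertex link is a combinatorial
`(d-1)`-sphere. -/
def IsCombManifold (d : ℕ) (K : Finset (Finset V)) : Prop :=
  IsComplex K ∧ ∀ v ∈ verts K, IsCombSphere (d - 1) (link K {v})

/-- A combinatorial `d`-manifold with boundary. -/
def IsCombManifoldWithBdry (d : ℕ) (K : Finset (Finset V)) : Prop :=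
  IsComplex K ∧
  (∀ v ∈ verts K, IsCombSphere (d - 1) (link K {v}) ∨
    IsCombBall (d - 1) (link K {v})) ∧
  (∃ v ∈ verts K, IsCombBall (d - 1) (link K {v}))

/-- A pl `k`-ball: a polyhedron carried by some geometric complex whose face
structure is a combinatorial `k`-ball. -/
def IsPLBall (k : ℕ) (P : Set (ℕ → ℝ)) : Prop :=
  ∃ G : GComplex, G.carrier = P ∧ IsCombBall k G.faces

/-- Elementary polyhedral collapse: `P = P' ∪ B` with `B` a pl `k`-ball and
`P' ∩ B` a pl `(k-1)`-ball. -/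
def PolyElemCollapse (P P' : Set (ℕ → ℝ)) : Prop :=
  ∃ k : ℕ, 1 ≤ k ∧ ∃ B : Set (ℕ → ℝ),
    IsPLBall k B ∧ P = P' ∪ B ∧ IsPLBall (k - 1) (P' ∩ B)

/-- Polyhedral collapse. -/
def PolyCollapsesTo (P Q : Set (ℕ → ℝ)) : Prop :=
  Relation.ReflTransGen PolyElemCollapse P Q

/-- Carrier of a subcomplex under a vertex realization map `f`. -/
def subCarrier (f : V → ℕ → ℝ) (L : Finset (Finset V)) : Set (ℕ → ℝ) :=
  ⋃ s ∈ L, convexHull ℝ ((s.image f : Finset (ℕ → ℝ)) : Set (ℕ → ℝ))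

/-! ### Bistellar moves. -/

/-- The core `β = {x ∈ A : A \ {x} ∈ X}` of a `(d+2)`-set `A`. -/
def bcore (X : Finset (Finset V)) (A : Finset V) : Finset V :=
  A.filter fun x => A.erase x ∈ X

/-- `κ_A` is a bistellar `i`-move on the `d`-dimensional complex `X`:
`A` has `d + 2` elements and contains at least one and at most `d + 1` facets
of `X`; with `β` the core of `A` and `α = A \ β` an `i`-face of `X`, one has
`β ∉ X`, and either `α` is a facet of `X` or `Lk_X(α)` has vertex set `β`. -/
def BistellarIMove (d i : ℕ) (X : Finset (Finset V)) (A : Finset V) : Prop :=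
  A.card = d + 2 ∧
  0 < ((facets X).filter fun σ => σ ⊆ A).card ∧
  ((facets X).filter fun σ => σ ⊆ A).card ≤ d + 1 ∧
  bcore X A ∉ X ∧
  A \ bcore X A ∈ X ∧ (A \ bcore X A).card = i + 1 ∧
  (A \ bcore X A ∈ facets X ∨ verts (link X (A \ bcore X A)) = bcore X A)

/-! ### The explicit small complexes of the paper. -/

/-- The complex generated by a list of facets: all nonempty subsets thereof. -/
def genBy (F : Finset (Finset ℕ)) : Finset (Finset ℕ) :=
  F.sup fun s => s.powerset.erase ∅

/-- The standard 2-sphere `S²₄`. -/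
def S24 : Finset (Finset ℕ) := stdSphere {1, 2, 3, 4}

/-- The join `S¹₃ * S⁰₂`. -/
def S13S02 : Finset (Finset ℕ) := sjoin (stdSphere {1, 2, 3}) (stdSphere {4, 5})

/-- The octahedron `S⁰₂ * S⁰₂ * S⁰₂`. -/
def Octa : Finset (Finset ℕ) :=
  sjoin (stdSphere {1, 2}) (sjoin (stdSphere {3, 4}) (stdSphere {5, 6}))

/-- The 6-vertex real projective plane `ℝP²₆`. -/
def RP26 : Finset (Finset ℕ) :=
  genBy {{1, 2, 3}, {1, 2, 4}, {1, 3, 5}, {1, 4, 6}, {1, 5, 6},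
         {2, 3, 6}, {2, 4, 5}, {2, 5, 6}, {3, 4, 5}, {3, 4, 6}}

/-- `Σ₁`: the 6-vertex 2-sphere with a vertex of degree 3 and one of degree 5. -/
def Sigma1 : Finset (Finset ℕ) :=
  genBy {{1, 2, 5}, {1, 2, 6}, {1, 5, 6}, {2, 3, 5},
         {2, 3, 6}, {3, 4, 5}, {3, 4, 6}, {4, 5, 6}}

/-- The double pyramid `S¹₅ * S⁰₂`. -/
def S15S02 : Finset (Finset ℕ) :=
  sjoin (genBy {{1, 2}, {2, 3}, {3, 4}, {4, 5}, {1, 5}}) (stdSphere {6, 7})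

/-- `Σ₂` (7-vertex 2-sphere with 10 triangles). -/
def Sigma2 : Finset (Finset ℕ) :=
  genBy {{1, 2, 6}, {1, 2, 7}, {1, 6, 7}, {2, 3, 6}, {2, 3, 7},
         {3, 4, 6}, {3, 4, 7}, {4, 5, 6}, {4, 5, 7}, {5, 6, 7}}

/-- `Σ₃` (7-vertex 2-sphere with 10 triangles). -/
def Sigma3 : Finset (Finset ℕ) :=
  genBy {{1, 2, 6}, {1, 2, 7}, {1, 6, 7}, {2, 3, 4}, {2, 3, 7},
         {2, 4, 6}, {3, 4, 7}, {4, 5, 6}, {4, 5, 7}, {5, 6, 7}}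

/-- `Σ₄` (7-vertex 2-sphere with 10 triangles). -/
def Sigma4 : Finset (Finset ℕ) :=
  genBy {{1, 2, 4}, {1, 2, 7}, {1, 4, 5}, {1, 5, 6}, {1, 6, 7},
         {2, 3, 4}, {2, 3, 7}, {3, 4, 7}, {4, 5, 7}, {5, 6, 7}}

/-- `Σ₅` (7-vertex 2-sphere with 10 triangles). -/
def Sigma5 : Finset (Finset ℕ) :=
  genBy {{1, 2, 3}, {1, 2, 6}, {1, 3, 5}, {1, 5, 6}, {2, 3, 4},
         {2, 4, 6}, {3, 4, 5}, {4, 5, 7}, {4, 6, 7}, {5, 6, 7}}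

/-- `Υ₁ = S²₄ ∪ S²₄`: two tetrahedral spheres sharing exactly one vertex. -/
def Upsilon1 : Finset (Finset ℕ) :=
  stdSphere {1, 2, 3, 7} ∪ stdSphere {4, 5, 6, 7}

/-- `Υ₂ = S²₄ ∪ (S⁰₂ * S¹₃)`: a tetrahedral sphere and a join, where the two
common vertices span an edge of the `S²₄`. -/
def Upsilon2 : Finset (Finset ℕ) :=
  stdSphere {4, 5, 6, 7} ∪ sjoin (stdSphere {6, 7}) (stdSphere {1, 2, 3})

/-- The complex `R` obtained from `ℝP²₆` by the generalized bistellar 1-move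
`κ_A`, `A = {1, 2, 5, 6}` (all such choices of `A` yield isomorphic complexes). -/
def Rcomplex : Finset (Finset ℕ) :=
  genBy {{1, 2, 3}, {1, 2, 4}, {1, 2, 5}, {1, 2, 6}, {1, 3, 5},
         {1, 4, 6}, {2, 3, 6}, {2, 4, 5}, {3, 4, 5}, {3, 4, 6}}

/-! ### Basic facts on the boundary operator -/

lemma mem_verts {K : Finset (Finset V)} {v : V} : v ∈ verts K ↔ ∃ s ∈ K, v ∈ s := by
  simp [verts, Finset.mem_sup]

lemma subset_verts {K : Finset (Finset V)} {s : Finset V} (hs : s ∈ K) : s ⊆ verts K :=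
  fun _ hv => mem_verts.2 ⟨s, hs, hv⟩

/-- The boundary operator relative to a vertex set, as a linear map. -/
def bd (S : Finset V) : (Finset V → ZMod 2) →ₗ[ZMod 2] (Finset V → ZMod 2) where
  toFun c := fun t => ∑ v ∈ S \ t, c (insert v t)
  map_add' c c' := by
    funext t
    simp [Finset.sum_add_distrib]
  map_smul' a c := by
    funext t
    simp [Finset.mul_sum]

lemma z2bdry_eq (K : Finset (Finset V)) (c : Finset V → ZMod 2) :
    z2bdry K c = bd (verts K) c := rfl

lemma bd_apply (S : Finset V) (c : Finset V → ZMod 2) (t : Finset V) :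
    bd S c t = ∑ v ∈ S \ t, c (insert v t) := rfl

lemma bd_bd (S : Finset V) (c : Finset V → ZMod 2) : bd S (bd S c) = 0 := by
  funext t
  simp only [bd_apply, Pi.zero_apply]
  rw [Finset.sum_sigma']
  refine Finset.sum_involution (fun p _ => ⟨p.2, p.1⟩) ?_ ?_ ?_ ?_
  · rintro ⟨v, w⟩ _
    simp only
    rw [Finset.insert_comm]
    exact CharTwo.add_self_eq_zero _
  · rintro ⟨v, w⟩ h _ heq
    simp only [Finset.mem_sigma, Finset.mem_sdiff, Finset.mem_insert] at h
    simp only [Sigma.mk.injEq] at heq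
    exact h.2.2 (Or.inl heq.1)
  · rintro ⟨v, w⟩ h
    simp only [Finset.mem_sigma, Finset.mem_sdiff, Finset.mem_insert] at h ⊢
    push Not at h ⊢
    exact ⟨⟨h.2.1, h.2.2.2⟩, h.1.1, fun e => h.2.2.1 e.symm, h.1.2⟩
  · rintro ⟨v, w⟩ h
    rfl

/-- The indicator of a set. -/
def ind (σ : Finset V) : Finset V → ZMod 2 := fun s => if s = σ then 1 else 0

lemma bd_ind {S σ : Finset V} (hσ : σ ⊆ S) :
    bd S (ind σ) = ∑ x ∈ σ, ind (σ.erase x) := by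
  funext t
  rw [bd_apply, Finset.sum_apply]
  simp only [ind]
  rw [← Finset.sum_filter, ← Finset.sum_filter]
  congr 1
  ext v
  simp only [Finset.mem_filter, Finset.mem_sdiff]
  constructor
  · rintro ⟨⟨_, hvt⟩, rfl⟩
    exact ⟨Finset.mem_insert_self _ _, (Finset.erase_insert hvt).symm⟩
  · rintro ⟨hv, rfl⟩
    exact ⟨⟨hσ hv, Finset.notMem_erase _ _⟩, Finset.insert_erase hv⟩

lemma chain_eq_sum {K : Finset (Finset V)} {n : ℕ} (hn : n ≠ 0) {c : Finset V → ZMod 2}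
    (hc : z2chainOK K n c) :
    c = ∑ s ∈ K.filter (fun s => s.card = n), c s • ind s := by
  funext t
  rw [Finset.sum_apply]
  simp only [Pi.smul_apply, ind, smul_eq_mul, mul_ite, mul_one, mul_zero]
  rw [Finset.sum_ite_eq]
  split_ifs with h
  · rfl
  · by_contra h0
    obtain ⟨h1, h2⟩ := hc t h0
    rcases h2 with h2 | h2
    · exact h (Finset.mem_filter.2 ⟨h2, h1⟩)
    · subst h2
      exact hn (by simpa using h1.symm)

lemma bd_mono {K : Finset (Finset V)} {n : ℕ} {S : Finset V} (hS : verts K ⊆ S)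
    {c : Finset V → ZMod 2} (hc : z2chainOK K n c) : bd S c = bd (verts K) c := by
  funext t
  rw [bd_apply, bd_apply]
  symm
  apply Finset.sum_subset (Finset.sdiff_subset_sdiff hS (Finset.Subset.refl _))
  intro v hv hv'
  by_contra h0
  obtain ⟨_, h | h⟩ := hc _ h0
  · apply hv'
    rw [Finset.mem_sdiff] at hv ⊢
    exact ⟨mem_verts.2 ⟨_, h, Finset.mem_insert_self _ _⟩, hv.2⟩
  · exact Finset.insert_ne_empty _ _ h

lemma verts_mono {K L : Finset (Finset V)} (h : K ⊆ L) : verts K ⊆ verts L := by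
  intro v hv
  obtain ⟨s, hs, hvs⟩ := mem_verts.1 hv
  exact mem_verts.2 ⟨s, h hs, hvs⟩

lemma chain_mono {K L : Finset (Finset V)} (h : K ⊆ L) {n : ℕ} {c : Finset V → ZMod 2}
    (hc : z2chainOK K n c) : z2chainOK L n c := by
  intro s hs
  obtain ⟨h1, h2⟩ := hc s hs
  exact ⟨h1, h2.imp (fun h' => h h') id⟩

lemma zmod2_cases (a : ZMod 2) : a = 0 ∨ a = 1 := by
  revert a; decide

/-- The boundary of a chain is a chain. -/
lemma bd_chain {K : Finset (Finset V)} (hK : IsComplex K) {n : ℕ} {c : Finset V → ZMod 2}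
    (hc : z2chainOK K (n + 1) c) : z2chainOK K n (bd (verts K) c) := by
  intro t ht
  rw [bd_apply] at ht
  obtain ⟨v, hv, hvt⟩ := Finset.exists_ne_zero_of_sum_ne_zero ht
  obtain ⟨h1, h2⟩ := hc _ hvt
  rw [Finset.mem_sdiff] at hv
  rw [Finset.card_insert_of_notMem hv.2] at h1
  refine ⟨by omega, ?_⟩
  rcases h2 with h2 | h2
  · rcases Finset.eq_empty_or_nonempty t with h | h
    · exact Or.inr h
    · exact Or.inl (hK.2.2 _ h2 _ (Finset.subset_insert _ _) h)
  · exact absurd h2 (Finset.insert_ne_empty _ _)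

/-! ### Elementary collapses of triangles -/

lemma acyclic_collapse {X : Finset (Finset V)} (hX : IsComplex X) (hac : Z2Acyclic X)
    {τ σ : Finset V} (hf : IsFreeFace X τ σ) (hτ : τ.card = 3) (hσ : σ.card = 4) :
    Z2Acyclic ((X.erase τ).erase σ) := by
  obtain ⟨hτX, hσX, hss, huniq⟩ := hf
  set Y := (X.erase τ).erase σ with hY
  have hYX : Y ⊆ X := (Finset.erase_subset _ _).trans (Finset.erase_subset _ _)
  have hmem : ∀ s, s ∈ Y ↔ s ≠ σ ∧ s ≠ τ ∧ s ∈ X := by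
    intro s; simp [hY]
  -- the coface
  have hcof : ∀ (c : Finset V → ZMod 2) (n : ℕ), z2chainOK X n c →
      bd (verts X) c τ = c σ := by
    intro c n hc
    obtain ⟨x, hx⟩ : ∃ x, σ \ τ = {x} := by
      rw [← Finset.card_eq_one, Finset.card_sdiff_of_subset hss.1]; omega
    have hxm : x ∈ σ \ τ := by rw [hx]; simp
    rw [Finset.mem_sdiff] at hxm
    have hins : insert x τ = σ := by
      apply Finset.eq_of_subset_of_card_le
      · intro y hy
        rcases Finset.mem_insert.1 hy with rfl | hy
        · exact hxm.1
        · exact hss.1 hy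
      · rw [Finset.card_insert_of_notMem hxm.2]; omega
    rw [bd_apply, Finset.sum_eq_single x, hins]
    · intro y hy hyx
      by_contra h0
      obtain ⟨_, h | h⟩ := hc _ h0
      · have hyτ : y ∉ τ := (Finset.mem_sdiff.1 hy).2
        have := huniq _ h (Finset.ssubset_insert hyτ)
        have hyσ : y ∈ σ \ τ := by
          rw [Finset.mem_sdiff, ← this]; exact ⟨Finset.mem_insert_self _ _, hyτ⟩
        rw [hx] at hyσ
        exact hyx (Finset.mem_singleton.1 hyσ)
      · exact Finset.insert_ne_empty _ _ h
    · intro h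
      exact absurd (Finset.mem_sdiff.2 ⟨subset_verts hσX hxm.1, hxm.2⟩) h
  intro n z hz hbz
  have hzX := chain_mono hYX hz
  rw [z2bdry_eq, ← bd_mono (verts_mono hYX) hz] at hbz
  obtain ⟨c, hc, hbc⟩ := hac n z hzX hbz
  rw [z2bdry_eq] at hbc
  have key : ∃ c', z2chainOK X (n + 1) c' ∧ bd (verts X) c' = z ∧ c' τ = 0 ∧ c' σ = 0 := by
    have hzτ : z τ = 0 := by
      by_contra h0
      obtain ⟨h1, h | h⟩ := hz _ h0
      · exact ((hmem _).1 h).2.1 rfl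
      · rw [h] at hτ; simp at hτ
    have hcσ : c σ = 0 := by
      rw [← hcof c _ hc, hbc, hzτ]
    by_cases hcτ : c τ = 0
    · exact ⟨c, hc, hbc, hcτ, hcσ⟩
    · have hn : n + 1 = 3 := by rw [← (hc _ hcτ).1]; exact hτ
      have hi : z2chainOK X 4 (ind σ) := by
        intro s hs
        have : s = σ := by
          by_contra h; exact hs (by simp [ind, h])
        subst this
        exact ⟨hσ, Or.inl hσX⟩
      have hbi := bd_chain hX hi
      refine ⟨c + bd (verts X) (ind σ), ?_, ?_, ?_, ?_⟩
      · intro s hs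
        by_cases h : c s = 0
        · have h' : bd (verts X) (ind σ) s ≠ 0 := by
            intro h'; exact hs (by simp [h, h'])
          rw [hn]; exact hbi _ h'
        · exact hc _ h
      · rw [map_add, hbc, bd_bd, add_zero]
      · rw [Pi.add_apply, hcof _ _ hi]
        rcases zmod2_cases (c τ) with h | h
        · exact absurd h hcτ
        · rw [h]; simp only [ind, if_true]; decide
      · rw [Pi.add_apply, hcσ, zero_add]
        by_contra h
        have := (hbi _ h).1
        omega
  obtain ⟨c', h1, h2, h3, h4⟩ := key
  have hcY : z2chainOK Y (n + 1) c' := by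
    intro s hs
    obtain ⟨h5, h6⟩ := h1 s hs
    refine ⟨h5, h6.imp (fun h => (hmem _).2 ⟨?_, ?_, h⟩) id⟩
    · rintro rfl; exact hs h4
    · rintro rfl; exact hs h3
  exact ⟨c', hcY, by rw [z2bdry_eq, ← bd_mono (verts_mono hYX) hcY, h2]⟩

/-- In a minimal complex, no triangle is a free face. -/
lemma no_free_triangle {X : Finset (Finset V)} (hX : IsComplex X)
    (hdim : ∀ s ∈ X, s.card ≤ 4)
    (hac : Z2Acyclic X) (hnc : ¬ Collapsible X)
    (hmin : ∀ Y : Finset (Finset V), Y ⊆ X → Y ≠ X → IsComplex Y →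
      ¬ (Z2Acyclic Y ∧ ¬ Collapsible Y))
    {τ σ : Finset V} (hτ : τ.card = 3) (hσ : σ.card = 4) (hτX : τ ∈ X) (hσX : σ ∈ X)
    (hs : τ ⊆ σ) : ∃ ρ ∈ X, ρ.card = 4 ∧ τ ⊆ ρ ∧ ρ ≠ σ := by
  by_contra hcon
  push Not at hcon
  have hss : τ ⊂ σ := by
    refine ⟨hs, fun h => ?_⟩
    have := Finset.card_le_card h
    omega
  have hf : IsFreeFace X τ σ := by
    refine ⟨hτX, hσX, hss, fun ρ hρ hτρ => hcon ρ hρ ?_ hτρ.1⟩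
    have h1 := Finset.card_lt_card hτρ
    have h2 := hdim ρ hρ
    omega
  have hYX : (X.erase τ).erase σ ⊆ X :=
    (Finset.erase_subset _ _).trans (Finset.erase_subset _ _)
  refine hmin ((X.erase τ).erase σ) hYX ?_ ?_ ⟨acyclic_collapse hX hac hf hτ hσ, ?_⟩
  · intro h
    rw [← h] at hσX
    simp at hσX
  · refine ⟨?_, fun h => hX.2.1 (hYX h), ?_⟩
    · obtain ⟨x, hx⟩ : τ.Nonempty := by
        rw [← Finset.card_pos]; omega
      refine ⟨{x}, ?_⟩
      simp only [Finset.mem_erase]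
      refine ⟨?_, ?_, hX.2.2 _ hτX _ (by simpa using hx) (by simp)⟩
      · intro h; rw [← h] at hσ; simp at hσ
      · intro h; rw [← h] at hτ; simp at hτ
    · intro s hsY t hts hne
      simp only [Finset.mem_erase] at hsY ⊢
      have hsc := hdim s hsY.2.2
      refine ⟨?_, ?_, hX.2.2 _ hsY.2.2 _ hts hne⟩
      · rintro rfl
        exact hsY.1 (Finset.eq_of_subset_of_card_le hts (by omega)).symm
      · rintro rfl
        by_cases h : t = s
        · exact hsY.2.1 h.symm
        · exact hsY.1 (hf.2.2.2 s hsY.2.2 (lt_of_le_of_ne hts h))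
  · rintro ⟨v, hv⟩
    exact hnc ⟨v, Relation.ReflTransGen.head ⟨τ, σ, hf, rfl⟩ hv⟩

/-! ### Pure three-dimensional complexes without free triangles -/

/-- A pure 3-dimensional complex in which no triangle is free. -/
structure Good (K : Finset (Finset V)) : Prop where
  cx : IsComplex K
  pure : ∀ s ∈ K, ∃ t ∈ K, t.card = 4 ∧ s ⊆ t
  nofree : ∀ τ ∈ K, ∀ σ ∈ K, τ.card = 3 → σ.card = 4 → τ ⊆ σ →
    ∃ ρ ∈ K, ρ.card = 4 ∧ τ ⊆ ρ ∧ ρ ≠ σ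

/-- The vertices of the link of `s`. -/
def Nb (K : Finset (Finset V)) (s : Finset V) : Finset V :=
  (verts K).filter fun v => v ∉ s ∧ insert v s ∈ K

lemma mem_Nb {K : Finset (Finset V)} {s : Finset V} {v : V} :
    v ∈ Nb K s ↔ v ∉ s ∧ insert v s ∈ K := by
  simp only [Nb, Finset.mem_filter]
  exact ⟨fun h => h.2, fun h => ⟨subset_verts h.2 (Finset.mem_insert_self _ _), h⟩⟩

lemma mem_Nb1 {K : Finset (Finset V)} {x y : V} :
    y ∈ Nb K {x} ↔ y ≠ x ∧ ({x, y} : Finset V) ∈ K := by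
  rw [mem_Nb, Finset.pair_comm x y, Finset.mem_singleton]

lemma mem_Nb2 {K : Finset (Finset V)} {a b c : V} :
    c ∈ Nb K {a, b} ↔ c ≠ a ∧ c ≠ b ∧ ({a, b, c} : Finset V) ∈ K := by
  rw [mem_Nb]
  have : (insert c {a, b} : Finset V) = {a, b, c} := by
    ext x; simp only [Finset.mem_insert, Finset.mem_singleton]; tauto
  rw [this]
  simp only [Finset.mem_insert, Finset.mem_singleton]
  tauto

lemma Nb1_symm {K : Finset (Finset V)} {x y : V} (h : y ∈ Nb K {x}) : x ∈ Nb K {y} := by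
  rw [mem_Nb1] at h ⊢
  rw [Finset.pair_comm]
  exact ⟨h.1.symm, h.2⟩

lemma Nb2_comm {K : Finset (Finset V)} {a b c : V} (h : c ∈ Nb K {a, b}) :
    c ∈ Nb K {b, a} := by
  rwa [Finset.pair_comm]

lemma Nb2_swap {K : Finset (Finset V)} {a b c : V} (hab : a ≠ b) (h : c ∈ Nb K {a, b}) :
    b ∈ Nb K {a, c} := by
  rw [mem_Nb2] at h ⊢
  refine ⟨hab.symm, h.2.1.symm, ?_⟩
  have : ({a, c, b} : Finset V) = {a, b, c} := by
    ext x; simp only [Finset.mem_insert, Finset.mem_singleton]; tauto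
  rw [this]; exact h.2.2

lemma Nb_step {K : Finset (Finset V)} (hK : IsComplex K) {s : Finset V} (hs : s.Nonempty)
    {x : V} (hx : x ∈ Nb K s) : insert x (Nb K (insert x s)) ⊆ Nb K s := by
  intro y hy
  rcases Finset.mem_insert.1 hy with rfl | hy
  · exact hx
  · rw [mem_Nb] at hy ⊢
    refine ⟨fun h => hy.1 (Finset.mem_insert_of_mem h), hK.2.2 _ hy.2 _ ?_ (by simp)⟩
    intro z hz
    simp only [Finset.mem_insert] at hz ⊢
    tauto

lemma self_notMem_Nb {K : Finset (Finset V)} {s : Finset V} {x : V} :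
    x ∉ Nb K (insert x s) := by
  rw [mem_Nb]
  simp

lemma Nb2_sub {K : Finset (Finset V)} (hK : IsComplex K) {a b c : V}
    (h : c ∈ Nb K {a, b}) : c ∈ Nb K {a} := by
  rw [mem_Nb2] at h
  rw [mem_Nb1]
  refine ⟨h.1, hK.2.2 _ h.2.2 _ ?_ (by simp)⟩
  intro z hz
  simp only [Finset.mem_insert, Finset.mem_singleton] at hz ⊢
  tauto

lemma Nb2_sub' {K : Finset (Finset V)} (hK : IsComplex K) {a b c : V}
    (h : c ∈ Nb K {a, b}) : c ∈ Nb K {b} := Nb2_sub hK (Nb2_comm h)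

namespace Good

variable {K : Finset (Finset V)}

lemma Nb_nonempty (hK : Good K) {s : Finset V} (hs : s ∈ K) (hc : s.card < 4) :
    ∃ x, x ∈ Nb K s := by
  obtain ⟨t, ht, ht4, hst⟩ := hK.pure s hs
  obtain ⟨x, hx, hxs⟩ := Finset.exists_mem_notMem_of_card_lt_card (by omega : s.card < t.card)
  refine ⟨x, mem_Nb.2 ⟨hxs, hK.cx.2.2 _ ht _ ?_ (by simp)⟩⟩
  exact Finset.insert_subset hx hst

lemma ne_of_mem (hK : Good K) {s : Finset V} (hs : s ∈ K) : s.Nonempty := by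
  rw [Finset.nonempty_iff_ne_empty]
  rintro rfl
  exact hK.cx.2.1 hs

lemma Nb3 (hK : Good K) {s : Finset V} (hs : s ∈ K) (hc : s.card = 3) :
    2 ≤ (Nb K s).card := by
  obtain ⟨x, hx⟩ := hK.Nb_nonempty hs (by omega)
  rw [mem_Nb] at hx
  obtain ⟨ρ, hρ, hρ4, hsρ, hne⟩ := hK.nofree s hs _ hx.2 hc
    (by rw [Finset.card_insert_of_notMem hx.1, hc]) (Finset.subset_insert _ _)
  obtain ⟨y, hy, hys⟩ := Finset.exists_mem_notMem_of_card_lt_card (by omega : s.card < ρ.card)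
  have hyρ : insert y s = ρ := by
    apply Finset.eq_of_subset_of_card_le (Finset.insert_subset hy hsρ)
    rw [Finset.card_insert_of_notMem hys]; omega
  have hxy : x ≠ y := by
    rintro rfl
    exact hne hyρ.symm
  have : ({x, y} : Finset V) ⊆ Nb K s := by
    intro z hz
    rw [Finset.mem_insert, Finset.mem_singleton] at hz
    rcases hz with rfl | rfl
    · exact mem_Nb.2 hx
    · exact mem_Nb.2 ⟨hys, by rw [hyρ]; exact hρ⟩
  calc 2 = ({x, y} : Finset V).card := (Finset.card_pair hxy).symm
    _ ≤ _ := Finset.card_le_card this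

lemma Nb_card_step (hK : Good K) {s : Finset V} (hs : s ∈ K) {x : V} (hx : x ∈ Nb K s) :
    (Nb K (insert x s)).card + 1 ≤ (Nb K s).card := by
  rw [← Finset.card_insert_of_notMem (self_notMem_Nb (K := K) (s := s) (x := x))]
  exact Finset.card_le_card (Nb_step hK.cx (hK.ne_of_mem hs) hx)

lemma Nb2 (hK : Good K) {s : Finset V} (hs : s ∈ K) (hc : s.card = 2) :
    3 ≤ (Nb K s).card := by
  obtain ⟨x, hx⟩ := hK.Nb_nonempty hs (by omega)
  have h1 := hK.Nb_card_step hs hx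
  rw [mem_Nb] at hx
  have := hK.Nb3 hx.2 (by rw [Finset.card_insert_of_notMem hx.1, hc])
  omega

lemma Nb1 (hK : Good K) {s : Finset V} (hs : s ∈ K) (hc : s.card = 1) :
    4 ≤ (Nb K s).card := by
  obtain ⟨x, hx⟩ := hK.Nb_nonempty hs (by omega)
  have h1 := hK.Nb_card_step hs hx
  rw [mem_Nb] at hx
  have := hK.Nb2 hx.2 (by rw [Finset.card_insert_of_notMem hx.1, hc])
  omega

lemma vert_mem (hK : Good K) {v : V} (hv : v ∈ verts K) : ({v} : Finset V) ∈ K := by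
  obtain ⟨s, hs, hvs⟩ := mem_verts.1 hv
  exact hK.cx.2.2 _ hs _ (by simpa using hvs) (by simp)

lemma Nb1' (hK : Good K) {v : V} (hv : v ∈ verts K) : 4 ≤ (Nb K {v}).card :=
  hK.Nb1 (hK.vert_mem hv) (by simp)

lemma Nb2' (hK : Good K) {v w : V} (h : w ∈ Nb K {v}) : 3 ≤ (Nb K {v, w}).card := by
  rw [mem_Nb1] at h
  exact hK.Nb2 h.2 (Finset.card_pair h.1.symm)

lemma Nb_sub_verts (s : Finset V) : Nb K s ⊆ verts K := Finset.filter_subset _ _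

lemma closed_nb_card (hK : Good K) {v : V} (hv : v ∈ verts K) :
    5 ≤ (insert v (Nb K {v})).card := by
  have : v ∉ Nb K {v} := by rw [mem_Nb1]; simp
  rw [Finset.card_insert_of_notMem this]
  have := hK.Nb1' hv
  omega

lemma closed_nb_sub {v : V} (hv : v ∈ verts K) : insert v (Nb K {v}) ⊆ verts K :=
  Finset.insert_subset hv (Nb_sub_verts _)

/-- Connectedness. -/
lemma connected (hK : Good K) (h7 : (verts K).card ≤ 7) (g : V → ZMod 2)
    (hg : ∀ x y, y ∈ Nb K {x} → g x = g y) {a b : V} (ha : a ∈ verts K) (hb : b ∈ verts K) :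
    g a = g b := by
  have h := hK.closed_nb_card ha
  have h' := hK.closed_nb_card hb
  have hmeet : ((insert a (Nb K {a})) ∩ (insert b (Nb K {b}))).Nonempty := by
    rw [← Finset.card_pos]
    have h1 := Finset.card_union_add_card_inter (insert a (Nb K {a})) (insert b (Nb K {b}))
    have h2 := Finset.card_le_card
      (Finset.union_subset (closed_nb_sub ha) (closed_nb_sub hb))
    omega
  obtain ⟨c, hc⟩ := hmeet
  rw [Finset.mem_inter] at hc
  have e1 : g a = g c := by
    rcases Finset.mem_insert.1 hc.1 with rfl | h
    · rfl
    · exact hg _ _ h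
  have e2 : g b = g c := by
    rcases Finset.mem_insert.1 hc.2 with rfl | h
    · rfl
    · exact hg _ _ h
  rw [e1, e2]

/-- A cocycle which vanishes on the edges at `v` vanishes on all edges
in the closed neighbourhood of `v`. -/
lemma cocycle_local (hK : Good K) (h7 : (verts K).card ≤ 7) (α : V → V → ZMod 2)
    (hsymm : ∀ a b, α a b = α b a)
    (hα : ∀ a b c, a ≠ b → c ∈ Nb K {a, b} → α a b + α a c + α b c = 0)
    {v : V} (hv : v ∈ verts K) (hαv : ∀ x, x ≠ v → α v x = 0)
    {a b : V} (ha : a ∈ Nb K {v}) (hb : b ∈ Nb K {v}) (hab : b ∈ Nb K {a}) :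
    α a b = 0 := by
  by_contra hne
  have hav : a ≠ v := (mem_Nb1.1 ha).1
  have hbv : b ≠ v := (mem_Nb1.1 hb).1
  have hba : b ≠ a := (mem_Nb1.1 hab).1
  -- triangles through v
  have htri : ∀ x y, x ≠ v → y ∈ Nb K {v, x} → α x y = 0 := by
    intro x y hx hy
    have h := hα v x y hx.symm hy
    rw [hαv x hx, hαv y (mem_Nb2.1 hy).1] at h
    simpa using h
  let Bad : V → V → Finset V := fun x y =>
    (Nb K {v}).filter fun c => c ≠ x ∧ c ≠ y ∧ c ∉ Nb K {v, x}
  have hBad : ∀ x y, x ∈ Nb K {v} → y ∈ Nb K {v} → x ≠ y → α x y ≠ 0 →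
      (Bad x y).card + 5 ≤ (Nb K {v}).card := by
    intro x y hx hy hxy h0
    have h3 := hK.Nb2' hx
    have hyN : y ∉ Nb K {v, x} := fun h => h0 (htri x y (mem_Nb1.1 hx).1 h)
    have hxN : x ∉ Nb K {v, x} := fun h => (mem_Nb2.1 h).2.1 rfl
    have hd : Disjoint (Bad x y) (insert x (insert y (Nb K {v, x}))) := by
      rw [Finset.disjoint_left]
      intro c hc hc'
      simp only [Bad, Finset.mem_filter] at hc
      simp only [Finset.mem_insert] at hc'
      tauto
    have hsub : Bad x y ∪ insert x (insert y (Nb K {v, x})) ⊆ Nb K {v} := by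
      intro c hc
      simp only [Bad, Finset.mem_union, Finset.mem_filter, Finset.mem_insert] at hc
      rcases hc with hc | rfl | rfl | hc
      · exact hc.1
      · exact hx
      · exact hy
      · exact Nb2_sub hK.cx hc
    have h4 := Finset.card_le_card hsub
    rw [Finset.card_union_of_disjoint hd, Finset.card_insert_of_notMem,
      Finset.card_insert_of_notMem hyN] at h4
    · omega
    · simp only [Finset.mem_insert, not_or]
      exact ⟨hxy, hxN⟩
  have hB1 := hBad a b ha hb hba.symm hne
  have hB2 := hBad b a hb ha hba (by rwa [hsymm])
  have hN := hK.Nb2' hab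
  have hO : (verts K \ insert v (Nb K {v})).card + (1 + (Nb K {v}).card) ≤ 7 := by
    have hvn : v ∉ Nb K {v} := by rw [mem_Nb1]; simp
    rw [Finset.card_sdiff_of_subset (closed_nb_sub hv), Finset.card_insert_of_notMem hvn]
    have := Finset.card_le_card (closed_nb_sub hv)
    rw [Finset.card_insert_of_notMem hvn] at this
    omega
  have hsub : Nb K {a, b} ⊆ Bad a b ∪ Bad b a ∪ (verts K \ insert v (Nb K {v})) := by
    intro c hc
    have hca : c ≠ a := (mem_Nb2.1 hc).1
    have hcb : c ≠ b := (mem_Nb2.1 hc).2.1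
    have hcc := hα a b c hba.symm hc
    have hcv : c ≠ v := by
      rintro rfl
      rw [hsymm a c, hsymm b c, hαv a hav, hαv b hbv] at hcc
      exact hne (by simpa using hcc)
    by_cases hcN : c ∈ Nb K {v}
    · by_cases h1 : c ∈ Nb K {v, a}
      · by_cases h2 : c ∈ Nb K {v, b}
        · rw [htri a c hav h1, htri b c hbv h2] at hcc
          exact absurd (by simpa using hcc) hne
        · simp only [Bad, Finset.mem_union, Finset.mem_filter]
          exact Or.inl (Or.inr ⟨hcN, hcb, hca, h2⟩)
      · simp only [Bad, Finset.mem_union, Finset.mem_filter]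
        exact Or.inl (Or.inl ⟨hcN, hca, hcb, h1⟩)
    · simp only [Finset.mem_union, Finset.mem_sdiff, Finset.mem_insert]
      refine Or.inr ⟨Nb_sub_verts _ hc, ?_⟩
      tauto
  have h5 := Finset.card_le_card hsub
  have h6 := Finset.card_union_le (Bad a b ∪ Bad b a) (verts K \ insert v (Nb K {v}))
  have h8 := Finset.card_union_le (Bad a b) (Bad b a)
  omega

/-- Every 1-cocycle is a coboundary. -/
lemma cocycle (hK : Good K) (h7 : (verts K).card ≤ 7) (α : V → V → ZMod 2)
    (hsymm : ∀ a b, α a b = α b a)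
    (hα : ∀ a b c, a ≠ b → c ∈ Nb K {a, b} → α a b + α a c + α b c = 0) :
    ∃ β : V → ZMod 2, ∀ a b, b ∈ Nb K {a} → α a b = β a + β b := by
  have hne : (verts K).Nonempty := by
    obtain ⟨s, hs⟩ := hK.cx.1
    obtain ⟨x, hx⟩ := hK.ne_of_mem hs
    exact ⟨x, subset_verts hs hx⟩
  obtain ⟨v, hv, hmax⟩ := Finset.exists_max_image (verts K) (fun v => (Nb K {v}).card) hne
  -- normalise
  let β₀ : V → ZMod 2 := fun x => if x = v then 0 else α v x
  let α' : V → V → ZMod 2 := fun a b => α a b + β₀ a + β₀ b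
  have two : ∀ x : ZMod 2, x + x = 0 := CharTwo.add_self_eq_zero
  have hsymm' : ∀ a b, α' a b = α' b a := by
    intro a b; simp only [α', hsymm a b]; ring
  have hα' : ∀ a b c, a ≠ b → c ∈ Nb K {a, b} → α' a b + α' a c + α' b c = 0 := by
    intro a b c hab hc
    have h := hα a b c hab hc
    have e : α' a b + α' a c + α' b c = (α a b + α a c + α b c) + (β₀ a + β₀ a)
      + (β₀ b + β₀ b) + (β₀ c + β₀ c) := by simp only [α']; ring
    rw [e, h, two (β₀ a), two (β₀ b), two (β₀ c)]; simp
  have hαv : ∀ x, x ≠ v → α' v x = 0 := by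
    intro x hx
    simp only [α', β₀, if_true, if_neg hx, add_zero, two]
  have hloc : ∀ a b, a ∈ Nb K {v} → b ∈ Nb K {v} → b ∈ Nb K {a} → α' a b = 0 :=
    fun a b ha hb hab => hK.cocycle_local h7 α' hsymm' hα' hv hαv ha hb hab
  have hvn : v ∉ Nb K {v} := by rw [mem_Nb1]; simp
  set O := verts K \ insert v (Nb K {v}) with hOdef
  have hO : O.card + (1 + (Nb K {v}).card) ≤ 7 := by
    rw [Finset.card_sdiff_of_subset (closed_nb_sub hv), Finset.card_insert_of_notMem hvn]
    have := Finset.card_le_card (closed_nb_sub hv)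
    rw [Finset.card_insert_of_notMem hvn] at this
    omega
  have hmemO : ∀ x, x ∈ verts K → x ∉ O → x = v ∨ x ∈ Nb K {v} := by
    intro x hx hxO
    simp only [hOdef, Finset.mem_sdiff, Finset.mem_insert, not_and, not_not] at hxO
    exact hxO hx
  have hOv : ∀ x ∈ O, x ≠ v ∧ x ∉ Nb K {v} := by
    intro x hx
    simp only [hOdef, Finset.mem_sdiff, Finset.mem_insert, not_or] at hx
    exact hx.2
  have h4 := hK.Nb1' hv
  have hκ : ∃ κ : ZMod 2, ∀ x ∈ O, ∀ y ∈ Nb K {x}, y ∈ Nb K {v} ∧ α' x y = κ := by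
    by_cases h5 : 5 ≤ (Nb K {v}).card
    · rcases Finset.eq_empty_or_nonempty O with hOe | ⟨w, hw⟩
      · exact ⟨0, by simp [hOe]⟩
      have hO1 : ∀ x ∈ O, x = w := by
        intro x hx
        exact Finset.card_le_one.1 (by omega) x hx w hw
      have hsub : Nb K {w} ⊆ Nb K {v} := by
        intro y hy
        have hyO : y ∉ O := fun h => (mem_Nb1.1 hy).1 (hO1 y h)
        rcases hmemO y (Nb_sub_verts _ hy) hyO with rfl | h
        · exact absurd (Nb1_symm hy) (hOv w hw).2
        · exact h
      have hcon : ∀ y ∈ Nb K {w}, ∀ c ∈ insert y (Nb K {w, y}), α' w c = α' w y := by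
        intro y hy c hc
        rcases Finset.mem_insert.1 hc with rfl | hc
        · rfl
        · have h := hα' w y c (mem_Nb1.1 hy).1.symm hc
          rw [hloc y c (hsub hy) (hsub (Nb2_sub hK.cx hc)) (Nb2_sub' hK.cx hc), add_zero] at h
          have := CharTwo.add_eq_zero.1 h
          exact this.symm
      obtain ⟨y₀, hy₀⟩ := hK.Nb_nonempty (hK.vert_mem (Finset.mem_sdiff.1 hw).1) (by simp)
      refine ⟨α' w y₀, ?_⟩
      intro x hx y hy
      obtain rfl := hO1 x hx
      refine ⟨hsub hy, ?_⟩
      have hcard : ∀ y ∈ Nb K {x}, 4 ≤ (insert y (Nb K {x, y})).card := by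
        intro y hy
        rw [Finset.card_insert_of_notMem (fun h => (mem_Nb2.1 h).2.1 rfl)]
        have := hK.Nb2' hy
        omega
      have hss : ∀ y ∈ Nb K {x}, insert y (Nb K {x, y}) ⊆ Nb K {v} := by
        intro y hy c hc
        apply hsub
        rcases Finset.mem_insert.1 hc with rfl | hc
        · exact hy
        · exact Nb2_sub hK.cx hc
      have hmeet : ((insert y (Nb K {x, y})) ∩ (insert y₀ (Nb K {x, y₀}))).Nonempty := by
        rw [← Finset.card_pos]
        have h1 := Finset.card_union_add_card_inter (insert y (Nb K {x, y}))
          (insert y₀ (Nb K {x, y₀}))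
        have h2 := Finset.card_le_card (Finset.union_subset (hss y hy) (hss y₀ hy₀))
        have h3 := hcard y hy
        have h3' := hcard y₀ hy₀
        have : 0 < O.card := Finset.card_pos.2 ⟨x, hx⟩
        omega
      obtain ⟨c, hc⟩ := hmeet
      rw [Finset.mem_inter] at hc
      rw [← hcon y hy c hc.1, hcon y₀ hy₀ c hc.2]
    · refine ⟨0, fun x hx => ?_⟩
      exfalso
      have hxK := (Finset.mem_sdiff.1 hx).1
      have hsub : Nb K {x} ⊆ O.erase x := by
        intro y hy
        rw [Finset.mem_erase]
        refine ⟨(mem_Nb1.1 hy).1, ?_⟩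
        by_contra hyO
        rcases hmemO y (Nb_sub_verts _ hy) hyO with rfl | hyv
        · exact (hOv x hx).2 (Nb1_symm hy)
        · have hvy := Nb1_symm hyv
          have hs : insert v (Nb K {v, y}) ⊆ Nb K {y} := by
            intro c hc
            rcases Finset.mem_insert.1 hc with rfl | hc
            · exact hvy
            · exact Nb2_sub' hK.cx hc
          have hvn' : v ∉ Nb K {v, y} := fun h => (mem_Nb2.1 h).1 rfl
          have heq : insert v (Nb K {v, y}) = Nb K {y} := by
            apply Finset.eq_of_subset_of_card_le hs
            rw [Finset.card_insert_of_notMem hvn']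
            have := hK.Nb2' hyv
            have := hmax y (Nb_sub_verts _ hy)
            omega
          have hxy : x ∈ insert v (Nb K {v, y}) := by rw [heq]; exact Nb1_symm hy
          rcases Finset.mem_insert.1 hxy with h | h
          · exact (hOv x hx).1 h
          · exact (hOv x hx).2 (Nb2_sub hK.cx h)
      have h1 := Finset.card_le_card hsub
      have h2 := hK.Nb1' hxK
      rw [Finset.card_erase_of_mem hx] at h1
      omega
  obtain ⟨κ, hκ⟩ := hκ
  have hfin : ∀ a b, b ∈ Nb K {a} →
      α' a b = (if a ∈ O then κ else 0) + (if b ∈ O then κ else 0) := by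
    intro a b hab
    have haK : a ∈ verts K := Nb_sub_verts _ (Nb1_symm hab)
    have hbK : b ∈ verts K := Nb_sub_verts _ hab
    have hO' : ∀ x ∈ Nb K {v}, x ∉ O := fun x hx h => (hOv x h).2 hx
    by_cases ha : a ∈ O
    · obtain ⟨h1, h2⟩ := hκ a ha b hab
      rw [if_pos ha, if_neg (hO' b h1), h2, add_zero]
    · by_cases hb : b ∈ O
      · obtain ⟨h1, h2⟩ := hκ b hb a (Nb1_symm hab)
        rw [if_neg ha, if_pos hb, hsymm', h2, zero_add]
      · rw [if_neg ha, if_neg hb, add_zero]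
        rcases hmemO a haK ha with rfl | ha'
        · exact hαv b (mem_Nb1.1 hab).1
        · rcases hmemO b hbK hb with rfl | hb'
          · rw [hsymm']; exact hαv a (mem_Nb1.1 ha').1
          · exact hloc a b ha' hb' hab
  refine ⟨fun x => β₀ x + (if x ∈ O then κ else 0), fun a b hab => ?_⟩
  have h := hfin a b hab
  have e : α a b + (β₀ a + β₀ a) + (β₀ b + β₀ b) = α' a b + β₀ a + β₀ b := by
    simp only [α']; ring
  rw [two (β₀ a), two (β₀ b), add_zero, add_zero] at e
  rw [e, h]
  ring

end Good

/-! ### The tetrahedral part of a complex is acyclic -/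

/-- The submodule of chains of level `n`. -/
def Ch (K : Finset (Finset V)) (n : ℕ) : Submodule (ZMod 2) (Finset V → ZMod 2) where
  carrier := {c | z2chainOK K n c}
  add_mem' := by
    intro a b ha hb s hs
    by_cases h : a s = 0
    · exact hb s (fun h' => hs (by simp [h, h']))
    · exact ha s h
  zero_mem' := by
    intro s hs
    exact absurd rfl hs
  smul_mem' := by
    intro r a ha s hs
    exact ha s (fun h => hs (by simp [h]))

lemma mem_Ch {K : Finset (Finset V)} {n : ℕ} {c : Finset V → ZMod 2} :
    c ∈ Ch K n ↔ z2chainOK K n c := Iff.rfl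

lemma ind_chain {K : Finset (Finset V)} {s : Finset V} (hs : s ∈ K) :
    z2chainOK K s.card (ind s) := by
  intro t ht
  have : t = s := by
    by_contra h; exact ht (by simp [ind, h])
  subst this
  exact ⟨rfl, Or.inl hs⟩

lemma bd_ind_pair {S : Finset V} {a b : V} (hab : a ≠ b) (h : ({a, b} : Finset V) ⊆ S) :
    bd S (ind {a, b}) = ind {a} + ind {b} := by
  rw [bd_ind h, Finset.sum_pair hab]
  have e1 : ({a, b} : Finset V).erase a = {b} := by
    ext x; simp only [Finset.mem_erase, Finset.mem_insert, Finset.mem_singleton]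
    constructor
    · tauto
    · rintro rfl; exact ⟨hab.symm, Or.inr rfl⟩
  have e2 : ({a, b} : Finset V).erase b = {a} := by
    ext x; simp only [Finset.mem_erase, Finset.mem_insert, Finset.mem_singleton]
    constructor
    · tauto
    · rintro rfl; exact ⟨hab, Or.inl rfl⟩
  rw [e1, e2, add_comm]

lemma bd_ind_triple {S : Finset V} {a b c : V} (hab : a ≠ b) (hac : a ≠ c) (hbc : b ≠ c)
    (h : ({a, b, c} : Finset V) ⊆ S) :
    bd S (ind {a, b, c}) = ind {a, b} + ind {a, c} + ind {b, c} := by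
  rw [bd_ind h, Finset.sum_insert (by simp [hab, hac]), Finset.sum_pair hbc]
  have e1 : ({a, b, c} : Finset V).erase a = {b, c} := by
    ext x; simp only [Finset.mem_erase, Finset.mem_insert, Finset.mem_singleton]
    constructor
    · tauto
    · rintro (rfl | rfl)
      · exact ⟨hab.symm, by tauto⟩
      · exact ⟨hac.symm, by tauto⟩
  have e2 : ({a, b, c} : Finset V).erase b = {a, c} := by
    ext x; simp only [Finset.mem_erase, Finset.mem_insert, Finset.mem_singleton]
    constructor
    · tauto
    · rintro (rfl | rfl)
      · exact ⟨hab, by tauto⟩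
      · exact ⟨hbc.symm, by tauto⟩
  have e3 : ({a, b, c} : Finset V).erase c = {a, b} := by
    ext x; simp only [Finset.mem_erase, Finset.mem_insert, Finset.mem_singleton]
    constructor
    · tauto
    · rintro (rfl | rfl)
      · exact ⟨hac, by tauto⟩
      · exact ⟨hbc, by tauto⟩
  rw [e1, e2, e3]
  abel

/-- A criterion for a cycle to be a boundary. -/
lemma boundary_criterion {K : Finset (Finset V)} {n : ℕ} {z : Finset V → ZMod 2}
    (h : ∀ φ : (Finset V → ZMod 2) →ₗ[ZMod 2] ZMod 2,
      (∀ s ∈ K, s.card = n + 1 → φ (bd (verts K) (ind s)) = 0) → φ z = 0) :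
    ∃ c', z2chainOK K (n + 1) c' ∧ z2bdry K c' = z := by
  by_contra hcon
  have hz : z ∉ (Ch K (n + 1)).map (bd (verts K)) := by
    rintro ⟨c, hc, hcz⟩
    exact hcon ⟨c, hc, hcz⟩
  obtain ⟨φ, hφ, hle⟩ := Submodule.exists_le_ker_of_notMem hz
  apply hφ
  apply h
  intro s hs hsn
  have : bd (verts K) (ind s) ∈ (Ch K (n + 1)).map (bd (verts K)) :=
    Submodule.mem_map_of_mem (by rw [mem_Ch, ← hsn]; exact ind_chain hs)
  exact hle this

lemma Good.h1 {K : Finset (Finset V)} (hK : Good K) (h7 : (verts K).card ≤ 7)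
    {z : Finset V → ZMod 2} (hz : z2chainOK K 2 z) (hbz : z2bdry K z = 0) :
    ∃ c', z2chainOK K (2 + 1) c' ∧ z2bdry K c' = z := by
  apply boundary_criterion
  intro φ hφ
  obtain ⟨β, hβ⟩ := hK.cocycle h7 (fun a b => φ (ind {a, b}))
    (fun a b => by simp only [Finset.pair_comm])
    (by
      intro a b c hab hc
      rw [mem_Nb2] at hc
      have h := hφ _ hc.2.2 (Finset.card_eq_three.2
        ⟨a, b, c, hab, hc.1.symm, hc.2.1.symm, rfl⟩)
      rw [bd_ind_triple hab hc.1.symm hc.2.1.symm (subset_verts hc.2.2), map_add, map_add] at h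
      exact h)
  let ψ : (Finset V → ZMod 2) →ₗ[ZMod 2] ZMod 2 :=
    (∑ x ∈ verts K, β x • LinearMap.proj (R := ZMod 2) (φ := fun _ : Finset V => ZMod 2) {x})
      ∘ₗ bd (verts K)
  have hψ : ∀ c, ψ c = ∑ x ∈ verts K, β x * bd (verts K) c {x} := by
    intro c
    simp [ψ, LinearMap.sum_apply]
  have hψz : ψ z = 0 := by
    rw [z2bdry_eq] at hbz
    rw [hψ, hbz]
    simp
  have key : φ z = ψ z := by
    rw [chain_eq_sum (by norm_num) hz, map_sum, map_sum]
    apply Finset.sum_congr rfl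
    intro s hs
    rw [map_smul, map_smul]
    congr 1
    obtain ⟨hsK, hs2⟩ := Finset.mem_filter.1 hs
    obtain ⟨a, b, hab, rfl⟩ := Finset.card_eq_two.1 hs2
    have h1 := hβ a b (mem_Nb1.2 ⟨hab.symm, hsK⟩)
    rw [h1, hψ, bd_ind_pair hab (subset_verts hsK)]
    have haS : a ∈ verts K := subset_verts hsK (by simp)
    have hbS : b ∈ verts K := subset_verts hsK (by simp)
    simp only [Pi.add_apply, ind, Finset.singleton_inj, mul_add, Finset.sum_add_distrib,
      mul_ite, mul_one, mul_zero, Finset.sum_ite_eq', haS, hbS, if_true]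
  rw [key, hψz]

lemma Good.h0 {K : Finset (Finset V)} (hK : Good K) (h7 : (verts K).card ≤ 7)
    {z : Finset V → ZMod 2} (hz : z2chainOK K 1 z) (hbz : z2bdry K z = 0) :
    ∃ c', z2chainOK K (1 + 1) c' ∧ z2bdry K c' = z := by
  apply boundary_criterion
  intro φ hφ
  obtain ⟨s, hs⟩ := hK.cx.1
  obtain ⟨v, hv⟩ := hK.ne_of_mem hs
  have hvK := subset_verts hs hv
  have hconst : ∀ a ∈ verts K, φ (ind {a}) = φ (ind {v}) := by
    intro a ha
    refine hK.connected h7 (fun x => φ (ind {x})) ?_ ha hvK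
    intro x y hxy
    rw [mem_Nb1] at hxy
    have h := hφ _ hxy.2 (Finset.card_pair hxy.1.symm)
    rw [bd_ind_pair hxy.1.symm (subset_verts hxy.2), map_add] at h
    exact CharTwo.add_eq_zero.1 h
  let ψ : (Finset V → ZMod 2) →ₗ[ZMod 2] ZMod 2 :=
    (φ (ind {v}) • LinearMap.proj (R := ZMod 2) (φ := fun _ : Finset V => ZMod 2) ∅)
      ∘ₗ bd (verts K)
  have hψ : ∀ c, ψ c = φ (ind {v}) * bd (verts K) c ∅ := by
    intro c
    simp [ψ]
  have hψz : ψ z = 0 := by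
    rw [z2bdry_eq] at hbz
    rw [hψ, hbz]
    simp
  have key : φ z = ψ z := by
    rw [chain_eq_sum (by norm_num) hz, map_sum, map_sum]
    apply Finset.sum_congr rfl
    intro s hs
    rw [map_smul, map_smul]
    congr 1
    obtain ⟨hsK, hs2⟩ := Finset.mem_filter.1 hs
    obtain ⟨a, rfl⟩ := Finset.card_eq_one.1 hs2
    rw [hconst a (subset_verts hsK (by simp)), hψ, bd_ind (subset_verts hsK),
      Finset.sum_singleton]
    have e : ({a} : Finset V).erase a = ∅ := by simp
    have e1 : (ind (∅ : Finset V)) ∅ = 1 := by simp [ind]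
    rw [e, e1, mul_one]
  rw [key, hψz]

/-- The subcomplex generated by the tetrahedra. -/
def tetPart (X : Finset (Finset V)) : Finset (Finset V) :=
  X.filter fun s => ∃ t ∈ X, t.card = 4 ∧ s ⊆ t

lemma good_not_collapsible {K : Finset (Finset V)} (hK : Good K) (h4 : ∀ s ∈ K, s.card ≤ 4) :
    ¬ Collapsible K := by
  rintro ⟨v, hv⟩
  rcases Relation.ReflTransGen.cases_head hv with h | ⟨L, ⟨τ, σ, hf, -⟩, -⟩
  · have hvK : ({v} : Finset V) ∈ K := by rw [h]; simp
    obtain ⟨t, ht, ht4, -⟩ := hK.pure _ hvK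
    rw [h, Finset.mem_singleton] at ht
    rw [ht] at ht4
    simp at ht4
  · obtain ⟨hτ, hσ, hss, huniq⟩ := hf
    have hlt := Finset.card_lt_card hss
    have hσ4 := h4 σ hσ
    have hpos : 0 < τ.card := Finset.card_pos.2 (hK.ne_of_mem hτ)
    have hN : 2 ≤ (Nb K τ).card := by
      have : τ.card = 1 ∨ τ.card = 2 ∨ τ.card = 3 := by omega
      rcases this with h | h | h
      · exact le_trans (by norm_num) (hK.Nb1 hτ h)
      · exact le_trans (by norm_num) (hK.Nb2 hτ h)
      · exact hK.Nb3 hτ h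
    obtain ⟨x, hx, y, hy, hxy⟩ := Finset.one_lt_card.1 hN
    rw [mem_Nb] at hx hy
    have e1 := huniq _ hx.2 (Finset.ssubset_insert hx.1)
    have e2 := huniq _ hy.2 (Finset.ssubset_insert hy.1)
    have : x ∈ insert y τ := by rw [e2, ← e1]; exact Finset.mem_insert_self _ _
    rcases Finset.mem_insert.1 this with h | h
    · exact hxy h
    · exact hx.1 h

/-- A minimal complex is good. -/
lemma minimal_good {X : Finset (Finset V)} (hX : IsComplex X) (h7 : (verts X).card = 7)
    (hdim : X.sup Finset.card = 4)
    (hac : Z2Acyclic X) (hnc : ¬ Collapsible X)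
    (hmin : ∀ Y : Finset (Finset V), Y ⊆ X → Y ≠ X → IsComplex Y →
      ¬ (Z2Acyclic Y ∧ ¬ Collapsible Y)) : Good X := by
  have hle : ∀ s ∈ X, s.card ≤ 4 := by
    intro s hs
    rw [← hdim]
    exact Finset.le_sup (f := Finset.card) hs
  set T := tetPart X with hT
  have hTX : T ⊆ X := Finset.filter_subset _ _
  have hmem : ∀ s, s ∈ T ↔ s ∈ X ∧ ∃ t ∈ X, t.card = 4 ∧ s ⊆ t := by
    intro s; simp only [hT, tetPart, Finset.mem_filter]
  have hT4 : ∀ s ∈ X, s.card = 4 → s ∈ T :=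
    fun s hs h => (hmem s).2 ⟨hs, s, hs, h, Finset.Subset.refl _⟩
  have hgood : Good T := by
    refine ⟨⟨?_, fun h => hX.2.1 (hTX h), ?_⟩, ?_, ?_⟩
    · obtain ⟨s, hs, hs4⟩ := Finset.exists_mem_eq_sup X hX.1 Finset.card
      exact ⟨s, hT4 s hs (by rw [← hs4, hdim])⟩
    · intro s hs t hts hne
      obtain ⟨h1, u, hu, hu4, hsu⟩ := (hmem s).1 hs
      exact (hmem t).2 ⟨hX.2.2 _ h1 _ hts hne, u, hu, hu4, hts.trans hsu⟩
    · intro s hs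
      obtain ⟨h1, u, hu, hu4, hsu⟩ := (hmem s).1 hs
      exact ⟨u, hT4 u hu hu4, hu4, hsu⟩
    · intro τ hτ σ hσ hτ3 hσ4 hs
      obtain ⟨ρ, hρ, hρ4, h⟩ := no_free_triangle hX hle hac hnc hmin hτ3 hσ4 (hTX hτ)
        (hTX hσ) hs
      exact ⟨ρ, hT4 ρ hρ hρ4, hρ4, h⟩
  have h7' : (verts T).card ≤ 7 := by
    rw [← h7]; exact Finset.card_le_card (verts_mono hTX)
  have hTac : Z2Acyclic T := by
    intro n z hz hbz
    rcases Nat.lt_or_ge n 3 with hn | hn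
    · interval_cases n
      · obtain ⟨s, hs⟩ := hgood.cx.1
        obtain ⟨v, hv⟩ := hgood.ne_of_mem hs
        have hvT := hgood.vert_mem (subset_verts hs hv)
        refine ⟨z ∅ • ind {v}, (Ch T 1).smul_mem _ (ind_chain hvT), ?_⟩
        rw [z2bdry_eq, map_smul, bd_ind (subset_verts hvT)]
        funext t
        by_cases ht : t = ∅
        · subst ht; simp [ind]
        · have : z t = 0 := by
            by_contra h
            exact ht (Finset.card_eq_zero.1 (hz t h).1)
          simp [ind, ht, this]
      · exact hgood.h0 h7' hz hbz
      · exact hgood.h1 h7' hz hbz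
    · rw [z2bdry_eq, ← bd_mono (verts_mono hTX) hz] at hbz
      obtain ⟨c, hc, hbc⟩ := hac n z (chain_mono hTX hz) hbz
      have hcT : z2chainOK T (n + 1) c := by
        intro s hs
        obtain ⟨h1, h2⟩ := hc s hs
        refine ⟨h1, h2.imp (fun h => ?_) id⟩
        have := hle s h
        exact hT4 s h (by omega)
      refine ⟨c, hcT, ?_⟩
      rw [z2bdry_eq, ← bd_mono (verts_mono hTX) hcT]
      exact hbc
  have hTeq : T = X := by
    by_contra hne
    exact hmin T hTX hne hgood.cx
      ⟨hTac, good_not_collapsible hgood (fun s hs => hle s (hTX hs))⟩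
  rw [← hTeq]
  exact hgood

/-! ### The Euler characteristic -/

/-- Faces of cardinality `n`, in the augmented sense. -/
def Fc (K : Finset (Finset V)) (n : ℕ) : Finset (Finset V) :=
  (insert ∅ K).filter fun s => s.card = n

/-- Restriction of chains to the faces. -/
def chRes (K : Finset (Finset V)) (n : ℕ) : Ch K n →ₗ[ZMod 2] (Fc K n → ZMod 2) where
  toFun c := fun s => c.1 s.1
  map_add' _ _ := rfl
  map_smul' _ _ := rfl

lemma mem_Fc {K : Finset (Finset V)} {n : ℕ} {s : Finset V} :
    s ∈ Fc K n ↔ s.card = n ∧ (s ∈ K ∨ s = ∅) := by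
  simp only [Fc, Finset.mem_filter, Finset.mem_insert]
  tauto

lemma chRes_bij (K : Finset (Finset V)) (n : ℕ) : Function.Bijective (chRes K n) := by
  constructor
  · intro c d h
    apply Subtype.ext
    funext s
    by_cases hs : s ∈ Fc K n
    · exact congrFun h ⟨s, hs⟩
    · have h1 : c.1 s = 0 := by
        by_contra h'
        exact hs (mem_Fc.2 (c.2 s h'))
      have h2 : d.1 s = 0 := by
        by_contra h'
        exact hs (mem_Fc.2 (d.2 s h'))
      rw [h1, h2]
  · intro g
    refine ⟨⟨fun s => if h : s ∈ Fc K n then g ⟨s, h⟩ else 0, ?_⟩, ?_⟩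
    · intro s hs
      by_cases h : s ∈ Fc K n
      · exact mem_Fc.1 h
      · exact absurd (dif_neg h) hs
    · funext s
      exact dif_pos s.2

/-- Chains are functions on the faces. -/
def chEquiv (K : Finset (Finset V)) (n : ℕ) : Ch K n ≃ₗ[ZMod 2] (Fc K n → ZMod 2) :=
  LinearEquiv.ofBijective (chRes K n) (chRes_bij K n)

lemma ch_finite (K : Finset (Finset V)) (n : ℕ) : Module.Finite (ZMod 2) (Ch K n) :=
  Module.Finite.equiv (chEquiv K n).symm

lemma ch_finrank (K : Finset (Finset V)) (n : ℕ) :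
    Module.finrank (ZMod 2) (Ch K n) = (Fc K n).card := by
  rw [(chEquiv K n).finrank_eq, Module.finrank_fintype_fun_eq_card, Fintype.card_coe]

/-- The dimension of a subspace. -/
def frk {F M : Type*} [Field F] [AddCommGroup M] [Module F M] (p : Submodule F M) : ℕ :=
  Module.finrank F p

lemma frk_add {F M : Type*} [Field F] [AddCommGroup M] [Module F M] (p : Submodule F M)
    [Module.Finite F p] (f : M →ₗ[F] M) :
    frk (p.map f) + frk (p ⊓ LinearMap.ker f) = frk p := by
  have h := LinearMap.finrank_range_add_finrank_ker (f.domRestrict p)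
  have e1 : LinearMap.range (f.domRestrict p) = p.map f := by
    ext c
    constructor
    · rintro ⟨d, rfl⟩
      exact ⟨d.1, d.2, rfl⟩
    · rintro ⟨d, hd, rfl⟩
      exact ⟨⟨d, hd⟩, rfl⟩
  have e2 : (LinearMap.ker (f.domRestrict p)).map p.subtype = p ⊓ LinearMap.ker f := by
    ext c
    constructor
    · rintro ⟨d, hd, rfl⟩
      exact ⟨d.2, hd⟩
    · rintro ⟨h1, h2⟩
      exact ⟨⟨c, h1⟩, h2, rfl⟩
  rw [← Submodule.finrank_map_subtype_eq, e1, e2] at h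
  exact h

lemma frk_bot {F M : Type*} [Field F] [AddCommGroup M] [Module F M] :
    frk (⊥ : Submodule F M) = 0 := finrank_bot F M

/-- The rank of the boundary map on level `n`. -/
def brk (K : Finset (Finset V)) (n : ℕ) : ℕ := frk ((Ch K n).map (bd (verts K)))

lemma brk_add {K : Finset (Finset V)} (hK : IsComplex K) (hac : Z2Acyclic K) (n : ℕ) :
    brk K n + brk K (n + 1) = (Fc K n).card := by
  haveI := ch_finite K n
  have h := frk_add (Ch K n) (bd (verts K))
  have e : frk (Ch K n) = (Fc K n).card := ch_finrank K n
  have : (Ch K (n + 1)).map (bd (verts K)) = Ch K n ⊓ LinearMap.ker (bd (verts K)) := by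
    ext c
    constructor
    · rintro ⟨d, hd, rfl⟩
      exact ⟨bd_chain hK hd, bd_bd _ _⟩
    · rintro ⟨h1, h2⟩
      obtain ⟨e, he, hed⟩ := hac n c h1 h2
      exact ⟨e, he, hed⟩
  rw [brk, brk, this, h, e]

lemma brk_zero (K : Finset (Finset V)) : brk K 0 = 0 := by
  have : (Ch K 0).map (bd (verts K)) = ⊥ := by
    rw [Submodule.eq_bot_iff]
    rintro _ ⟨c, hc, rfl⟩
    funext t
    change ∑ v ∈ verts K \ t, c (insert v t) = 0
    apply Finset.sum_eq_zero
    intro v _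
    by_contra h
    have := (hc _ h).1
    simp at this
  rw [brk, this, frk_bot]

lemma Fc_card_succ (K : Finset (Finset V)) (n : ℕ) : (Fc K (n + 1)).card = fvec K n := by
  rw [fvec]
  congr 1
  ext s
  rw [mem_Fc, Finset.mem_filter]
  constructor
  · rintro ⟨h, h' | h'⟩
    · exact ⟨h', h⟩
    · subst h'; simp at h
  · rintro ⟨h, h'⟩
    exact ⟨h', Or.inl h⟩

lemma Fc_card_zero (K : Finset (Finset V)) : (Fc K 0).card = 1 := by
  rw [Finset.card_eq_one]
  refine ⟨∅, ?_⟩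
  ext s
  rw [mem_Fc, Finset.card_eq_zero, Finset.mem_singleton]
  tauto

lemma euler {K : Finset (Finset V)} (hK : IsComplex K) (hac : Z2Acyclic K)
    (h4 : ∀ s ∈ K, s.card ≤ 4) : fvec K 0 + fvec K 2 = 1 + fvec K 1 + fvec K 3 := by
  have e0 := brk_add hK hac 0
  have e1 := brk_add hK hac 1
  have e2 := brk_add hK hac 2
  have e3 := brk_add hK hac 3
  have e4 := brk_add hK hac 4
  have e5 := brk_add hK hac 5
  rw [Fc_card_zero, brk_zero] at e0
  rw [Fc_card_succ K] at e1 e2 e3 e4 e5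
  norm_num only at e0 e1 e2 e3 e4 e5
  have h5 : fvec K 4 = 0 := by
    rw [fvec, Finset.card_eq_zero, Finset.filter_eq_empty_iff]
    intro s hs h
    have := h4 s hs
    omega
  omega

lemma fvec_zero {K : Finset (Finset V)} (hK : Good K) : fvec K 0 = (verts K).card := by
  rw [fvec]
  symm
  refine Finset.card_bij (fun v _ => ({v} : Finset V)) ?_ ?_ ?_
  · intro v hv
    exact Finset.mem_filter.2 ⟨hK.vert_mem hv, by simp⟩
  · intro a _ b _ h
    exact Finset.singleton_injective h
  · intro s hs
    obtain ⟨h1, h2⟩ := Finset.mem_filter.1 hs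
    obtain ⟨a, rfl⟩ := Finset.card_eq_one.1 h2
    exact ⟨a, subset_verts h1 (by simp), rfl⟩

/-! ### Excluding the projective plane as a vertex link -/

lemma mem_Nb3 {K : Finset (Finset V)} {v a b w : V} :
    w ∈ Nb K {v, a, b} ↔ w ≠ v ∧ w ≠ a ∧ w ≠ b ∧ ({v, a, b, w} : Finset V) ∈ K := by
  rw [mem_Nb]
  have : (insert w {v, a, b} : Finset V) = {v, a, b, w} := by
    ext x; simp only [Finset.mem_insert, Finset.mem_singleton]; tauto
  rw [this]
  simp only [Finset.mem_insert, Finset.mem_singleton, not_or]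
  tauto

lemma Nb3_swap {K : Finset (Finset V)} {v a b w : V} (hvb : v ≠ b) (hab : a ≠ b)
    (h : w ∈ Nb K {v, a, b}) : b ∈ Nb K {v, a, w} := by
  rw [mem_Nb3] at h ⊢
  obtain ⟨h1, h2, h3, h4⟩ := h
  refine ⟨hvb.symm, hab.symm, h3.symm, ?_⟩
  rwa [Finset.pair_comm w b]

lemma tri_comm (v a b : V) : ({v, a, b} : Finset V) = {v, b, a} := by
  rw [Finset.pair_comm a b]

/-- The data of a vertex whose link looks like a 2-neighbourly closed surface on six vertices. -/
structure Surf (K : Finset (Finset V)) (v : V) (R : Finset V) : Prop where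
  vR : v ∉ R
  cardR : R.card = 6
  all : verts K = insert v R
  tri : ∀ a ∈ R, ∀ b ∈ R, a ≠ b → ({v, a, b} : Finset V) ∈ K
  two : ∀ a ∈ R, ∀ b ∈ R, a ≠ b → (Nb K {v, a, b}).card = 2

namespace Surf

variable {K : Finset (Finset V)} {v : V} {R : Finset V}

lemma nb_sub (h : Surf K v R) {a b w : V} (hw : w ∈ Nb K {v, a, b}) :
    w ∈ (R.erase a).erase b := by
  have h1 := Good.Nb_sub_verts _ hw
  rw [mem_Nb3] at hw
  rw [h.all, Finset.mem_insert] at h1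
  rw [Finset.mem_erase, Finset.mem_erase]
  exact ⟨hw.2.2.1, hw.2.1, h1.resolve_left hw.1⟩

lemma meet (h : Surf K v R) {d : V} (hd : d ∈ R) {A B : Finset V} (hA : A ⊆ R.erase d)
    (hB : B ⊆ R.erase d) (hA3 : A.card = 3) (hB3 : B.card = 3) : ∃ w, w ∈ A ∧ w ∈ B := by
  by_contra hcon
  push Not at hcon
  have hdis : Disjoint A B := Finset.disjoint_left.2 hcon
  have h1 := Finset.card_le_card (Finset.union_subset hA hB)
  rw [Finset.card_union_of_disjoint hdis, Finset.card_erase_of_mem hd, h.cardR] at h1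
  omega

lemma cl_sub (h : Surf K v R) {d a : V} (ha : a ∈ R) (hda : d ≠ a) :
    insert a (Nb K {v, d, a}) ⊆ R.erase d := by
  intro w hw
  rcases Finset.mem_insert.1 hw with rfl | hw
  · exact Finset.mem_erase.2 ⟨hda.symm, ha⟩
  · exact Finset.mem_of_mem_erase (h.nb_sub hw)

lemma cl_card (h : Surf K v R) {d a : V} (hd : d ∈ R) (ha : a ∈ R) (hda : d ≠ a) :
    (insert a (Nb K {v, d, a})).card = 3 := by
  rw [Finset.card_insert_of_notMem, h.two d hd a ha hda]
  intro hw
  exact (mem_Nb3.1 hw).2.2.1 rfl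

/-- Local constancy around an edge implies global constancy. -/
lemma const (h : Surf K v R) {d : V} (hd : d ∈ R) (g : V → ZMod 2)
    (hg : ∀ a ∈ R, d ≠ a → ∀ w ∈ Nb K {v, d, a}, g a = g w)
    {a b : V} (ha : a ∈ R) (hda : d ≠ a) (hb : b ∈ R) (hdb : d ≠ b) : g a = g b := by
  obtain ⟨w, hwa, hwb⟩ := h.meet hd (h.cl_sub ha hda) (h.cl_sub hb hdb)
    (h.cl_card hd ha hda) (h.cl_card hd hb hdb)
  have e1 : g a = g w := by
    rcases Finset.mem_insert.1 hwa with e | e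
    · rw [e]
    · exact hg a ha hda w e
  have e2 : g b = g w := by
    rcases Finset.mem_insert.1 hwb with e | e
    · rw [e]
    · exact hg b hb hdb w e
  rw [e1, e2]

/-- Every triangle in the base of the cone is covered. -/
lemma cover (h : Surf K v R) (hK : Good K) (hac : Z2Acyclic K) {τ : Finset V} (hτR : τ ⊆ R)
    (hτ3 : τ.card = 3) (hτ : τ ∈ K) : insert v τ ∈ K := by
  by_contra hσ
  set σ := insert v τ with hσdef
  have hvτ : v ∉ τ := fun h' => h.vR (hτR h')
  have hvS : v ∈ verts K := by rw [h.all]; exact Finset.mem_insert_self _ _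
  have hσS : σ ⊆ verts K := Finset.insert_subset hvS (subset_verts hτ)
  have hz : bd (verts K) (ind σ) ∈ Ch K 3 := by
    rw [bd_ind hσS]
    apply Submodule.sum_mem
    intro x hx
    have hc : (σ.erase x).card = 3 := by
      rw [Finset.card_erase_of_mem hx, hσdef, Finset.card_insert_of_notMem hvτ, hτ3]
    have hm : σ.erase x ∈ K := by
      rcases Finset.mem_insert.1 hx with e | e
      · rw [e, hσdef, Finset.erase_insert hvτ]; exact hτ
      · have hxv : v ≠ x := fun e' => hvτ (e' ▸ e)
        have h2 : (τ.erase x).card = 2 := by rw [Finset.card_erase_of_mem e, hτ3]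
        rw [hσdef, Finset.erase_insert_of_ne hxv]
        obtain ⟨a, b, hab, hE⟩ := Finset.card_eq_two.1 h2
        have ha : a ∈ τ.erase x := by rw [hE]; simp
        have hb : b ∈ τ.erase x := by rw [hE]; simp
        rw [hE]
        exact h.tri a (hτR (Finset.mem_of_mem_erase ha)) b (hτR (Finset.mem_of_mem_erase hb)) hab
    have := ind_chain hm
    rw [hc] at this
    exact this
  obtain ⟨c, hc, hbc⟩ := hac 3 _ hz (bd_bd _ _)
  rw [z2bdry_eq] at hbc
  set y : Finset V → ZMod 2 := c + ind σ with hy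
  have hby : bd (verts K) y = 0 := by
    rw [hy, map_add, hbc]
    funext t
    exact CharTwo.add_self_eq_zero _
  have hyσ : y σ = 1 := by
    have : c σ = 0 := by
      by_contra h'
      rcases (hc σ h').2 with h'' | h''
      · exact hσ h''
      · rw [h''] at hσdef
        exact absurd hσdef.symm (Finset.insert_ne_empty _ _)
    rw [hy, Pi.add_apply, this]
    simp [ind]
  have hy0 : ∀ s : Finset V, s.Nonempty → s ∉ K → s ≠ σ → y s = 0 := by
    intro s hs hsK hsσ
    have : c s = 0 := by
      by_contra h'
      rcases (hc s h').2 with h'' | h''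
      · exact hsK h''
      · exact hs.ne_empty h''
    rw [hy, Pi.add_apply, this]
    simp [ind, hsσ]
  -- the two tetrahedra at an edge leaving the triangle
  have hpair : ∀ d ∈ R, d ∉ τ → ∀ a ∈ R, d ≠ a → ∃ κ : ZMod 2,
      ∀ w ∈ Nb K {v, d, a}, y {v, d, a, w} = κ := by
    intro d hd hdτ a ha hda
    obtain ⟨w1, w2, hne, hE⟩ := Finset.card_eq_two.1 (h.two d hd a ha hda)
    have h0 := congrFun hby {v, d, a}
    rw [bd_apply, Pi.zero_apply] at h0
    have h1 : ∑ w ∈ Nb K {v, d, a}, y (insert w {v, d, a}) = 0 := by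
      rw [← h0]
      apply Finset.sum_subset
      · intro w hw
        rw [Finset.mem_sdiff]
        exact ⟨Good.Nb_sub_verts _ hw, (mem_Nb.1 hw).1⟩
      · intro w hw hw'
        apply hy0
        · exact Finset.insert_nonempty _ _
        · intro hK'
          exact hw' (mem_Nb.2 ⟨(Finset.mem_sdiff.1 hw).2, hK'⟩)
        · intro e
          have : d ∈ σ := by rw [← e]; simp
          rcases Finset.mem_insert.1 this with e' | e'
          · exact h.vR (e' ▸ hd)
          · exact hdτ e'
    have hi : ∀ w, (insert w {v, d, a} : Finset V) = {v, d, a, w} := by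
      intro w
      ext x; simp only [Finset.mem_insert, Finset.mem_singleton]; tauto
    rw [hE, Finset.sum_pair hne, hi, hi] at h1
    have h2 := CharTwo.add_eq_zero.1 h1
    refine ⟨y {v, d, a, w1}, ?_⟩
    intro w hw
    rw [hE, Finset.mem_insert, Finset.mem_singleton] at hw
    rcases hw with rfl | rfl
    · rfl
    · exact h2.symm
  choose! g hg using hpair
  have hgd : ∀ d ∈ R, d ∉ τ → ∀ a ∈ R, d ≠ a → ∀ w ∈ Nb K {v, d, a}, g d a = g d w := by
    intro d hd hdτ a ha hda w hw
    have hva : v ≠ a := fun e => h.vR (e ▸ ha)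
    have hw' := Nb3_swap hva hda hw
    have hwR := h.nb_sub hw
    rw [Finset.mem_erase, Finset.mem_erase] at hwR
    rw [← hg d hd hdτ a ha hda w hw, ← hg d hd hdτ w hwR.2.2 hwR.2.1.symm a hw',
      Finset.pair_comm a w]
  have hgc : ∀ d ∈ R, d ∉ τ → ∀ a ∈ R, d ≠ a → ∀ b ∈ R, d ≠ b → g d a = g d b :=
    fun d hd hdτ a ha hda b hb hdb => h.const hd (g d) (hgd d hd hdτ) ha hda hb hdb
  have hgs : ∀ d ∈ R, d ∉ τ → ∀ e ∈ R, e ∉ τ → d ≠ e → g d e = g e d := by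
    intro d hd hdτ e he heτ hde
    obtain ⟨w, hw⟩ : (Nb K {v, d, e}).Nonempty := by
      rw [← Finset.card_pos, h.two d hd e he hde]; norm_num
    rw [← hg d hd hdτ e he hde w hw]
    rw [tri_comm] at hw
    rw [← hg e he heτ d hd hde.symm w hw]
    congr 1
    ext x; simp only [Finset.mem_insert, Finset.mem_singleton]; tauto
  obtain ⟨a, b, e, hab, hae, hbe, hτE⟩ := Finset.card_eq_three.1 hτ3
  have haτ : a ∈ τ := by rw [hτE]; simp
  have hbτ : b ∈ τ := by rw [hτE]; simp
  have heτ : e ∈ τ := by rw [hτE]; simp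
  have haR := hτR haτ
  have hbR := hτR hbτ
  obtain ⟨w1, w2, hne, hE⟩ := Finset.card_eq_two.1 (h.two a haR b hbR hab)
  have hσE : insert e ({v, a, b} : Finset V) = σ := by
    rw [hσdef, hτE]
    ext x; simp only [Finset.mem_insert, Finset.mem_singleton]; tauto
  have hw : ∀ w ∈ Nb K {v, a, b}, w ∈ R ∧ w ∉ τ := by
    intro w hw
    have h1 := h.nb_sub hw
    rw [Finset.mem_erase, Finset.mem_erase] at h1
    refine ⟨h1.2.2, ?_⟩
    rw [hτE]
    simp only [Finset.mem_insert, Finset.mem_singleton]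
    rintro (e1 | e1 | e1)
    · exact h1.2.1 e1
    · exact h1.1 e1
    · rw [mem_Nb, e1, hσE] at hw
      exact hσ hw.2
  have hval : ∀ w ∈ Nb K {v, a, b}, y (insert w {v, a, b}) = g w a := by
    intro w hwN
    obtain ⟨hwR, hwτ⟩ := hw w hwN
    have hwa : w ≠ a := fun e' => hwτ (e' ▸ haτ)
    have hva : v ≠ a := fun e' => h.vR (e' ▸ haR)
    have hvb : v ≠ b := fun e' => h.vR (e' ▸ hbR)
    have hbN : b ∈ Nb K {v, w, a} := by
      rw [tri_comm]; exact Nb3_swap hvb hab hwN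
    rw [← hg w hwR hwτ a haR hwa b hbN]
    congr 1
    ext x; simp only [Finset.mem_insert, Finset.mem_singleton]; tauto
  have hw1 : w1 ∈ Nb K {v, a, b} := by rw [hE]; simp
  have hw2 : w2 ∈ Nb K {v, a, b} := by rw [hE]; simp
  have heq : g w1 a = g w2 a := by
    obtain ⟨h1, h1'⟩ := hw w1 hw1
    obtain ⟨h2, h2'⟩ := hw w2 hw2
    rw [hgc w1 h1 h1' a haR (fun e' => h1' (e' ▸ haτ)) w2 h2 hne,
      hgs w1 h1 h1' w2 h2 h2' hne,
      hgc w2 h2 h2' w1 h1 hne.symm a haR (fun e' => h2' (e' ▸ haτ))]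
  have h0 := congrFun hby {v, a, b}
  rw [bd_apply, Pi.zero_apply] at h0
  have heN : e ∉ Nb K {v, a, b} := fun h' => (hw e h').2 heτ
  have h1 : ∑ w ∈ insert e (Nb K {v, a, b}), y (insert w {v, a, b}) = 0 := by
    rw [← h0]
    apply Finset.sum_subset
    · intro w hw
      rw [Finset.mem_sdiff]
      rcases Finset.mem_insert.1 hw with rfl | hw
      · refine ⟨hσS (Finset.mem_insert_of_mem heτ), ?_⟩
        simp only [Finset.mem_insert, Finset.mem_singleton]
        rintro (e1 | e1 | e1)
        · exact hvτ (e1 ▸ heτ)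
        · exact hae e1.symm
        · exact hbe e1.symm
      · exact ⟨Good.Nb_sub_verts _ hw, (mem_Nb.1 hw).1⟩
    · intro w hw1 hw2
      rw [Finset.mem_insert, not_or] at hw2
      apply hy0
      · exact Finset.insert_nonempty _ _
      · intro hK'
        exact hw2.2 (mem_Nb.2 ⟨(Finset.mem_sdiff.1 hw1).2, hK'⟩)
      · intro e'
        have : e ∈ insert w ({v, a, b} : Finset V) := by
          rw [e']; exact Finset.mem_insert_of_mem heτ
        simp only [Finset.mem_insert, Finset.mem_singleton] at this
        rcases this with e1 | e1 | e1 | e1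
        · exact hw2.1 e1.symm
        · exact hvτ (e1 ▸ heτ)
        · exact hae e1.symm
        · exact hbe e1.symm
  rw [Finset.sum_insert heN, hE, Finset.sum_pair hne, hval w1 hw1, hval w2 hw2, hσE, hyσ,
    heq, CharTwo.add_self_eq_zero] at h1
  simp at h1

lemma contra (h : Surf K v R) (hK : Good K) (hac : Z2Acyclic K) : False := by
  obtain ⟨a, haR⟩ : R.Nonempty := by rw [← Finset.card_pos, h.cardR]; norm_num
  obtain ⟨b, hb⟩ : (R.erase a).Nonempty := by
    rw [← Finset.card_pos, Finset.card_erase_of_mem haR, h.cardR]; norm_num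
  rw [Finset.mem_erase] at hb
  obtain ⟨hba, hbR⟩ := hb
  obtain ⟨c, hcN⟩ : (Nb K {v, a, b}).Nonempty := by
    rw [← Finset.card_pos, h.two a haR b hbR hba.symm]; norm_num
  have hcR := h.nb_sub hcN
  rw [Finset.mem_erase, Finset.mem_erase] at hcR
  obtain ⟨hcb, hca, hcR⟩ := hcR
  have hvab := (mem_Nb3.1 hcN).2.2.2
  have hτ : ({a, b, c} : Finset V) ∈ K :=
    hK.cx.2.2 _ hvab _ (Finset.subset_insert _ _) (by simp)
  have hτ3 : ({a, b, c} : Finset V).card = 3 :=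
    Finset.card_eq_three.2 ⟨a, b, c, hba.symm, hca.symm, hcb.symm, rfl⟩
  obtain ⟨x, hxN, hxv⟩ := Finset.exists_mem_ne (hK.Nb3 hτ hτ3) v
  have hxS := Good.Nb_sub_verts _ hxN
  rw [h.all, Finset.mem_insert] at hxS
  have hxR := hxS.resolve_left hxv
  rw [mem_Nb3] at hxN
  obtain ⟨hxa, hxb, hxc, habcx⟩ := hxN
  have key : ∀ p q r : V, p ∈ R → q ∈ R → r ∈ R → p ≠ q → p ≠ r → q ≠ r →
      ({p, q, r} : Finset V) ⊆ {a, b, c, x} → r ∈ Nb K {v, p, q} := by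
    intro p q r hp hq hr hpq hpr hqr hsub
    have h1 : ({p, q, r} : Finset V) ∈ K := hK.cx.2.2 _ habcx _ hsub (by simp)
    have h2 := h.cover hK hac (τ := {p, q, r}) (by
      intro z hz
      simp only [Finset.mem_insert, Finset.mem_singleton] at hz
      rcases hz with rfl | rfl | rfl <;> assumption)
      (Finset.card_eq_three.2 ⟨p, q, r, hpq, hpr, hqr, rfl⟩) h1
    exact mem_Nb3.2 ⟨fun e => h.vR (e ▸ hr), hpr.symm, hqr.symm, h2⟩
  have eqpair : ∀ p q r s : V, p ∈ R → q ∈ R → p ≠ q → r ≠ s → r ∈ Nb K {v, p, q} →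
      s ∈ Nb K {v, p, q} → ∀ w ∈ Nb K {v, p, q}, w = r ∨ w = s := by
    intro p q r s hp hq hpq hrs hr hs w hw
    have : ({r, s} : Finset V) = Nb K {v, p, q} := by
      apply Finset.eq_of_subset_of_card_le
      · intro z hz
        simp only [Finset.mem_insert, Finset.mem_singleton] at hz
        rcases hz with rfl | rfl <;> assumption
      · rw [h.two p hp q hq hpq, Finset.card_pair hrs]
    rw [← this] at hw
    simpa using hw
  have sub : ∀ p q r : V, p = a → (q = b ∨ q = c ∨ q = x) → (r = b ∨ r = c ∨ r = x) →
      ({p, q, r} : Finset V) ⊆ {a, b, c, x} := by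
    intro p q r hp hq hr z hz
    simp only [Finset.mem_insert, Finset.mem_singleton] at hz ⊢
    rcases hz with rfl | rfl | rfl <;> tauto
  obtain ⟨y, hyR, hy4⟩ : ∃ y ∈ R, y ∉ ({a, b, c, x} : Finset V) := by
    apply Finset.exists_mem_notMem_of_card_lt_card
    rw [h.cardR]
    exact lt_of_le_of_lt Finset.card_le_four (by norm_num)
  simp only [Finset.mem_insert, Finset.mem_singleton, not_or] at hy4
  obtain ⟨hya, hyb, hyc, hyx⟩ := hy4
  have hB : ({b, c, x} : Finset V) ⊆ R.erase a := by
    intro z hz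
    simp only [Finset.mem_insert, Finset.mem_singleton] at hz
    rw [Finset.mem_erase]
    rcases hz with rfl | rfl | rfl
    · exact ⟨hba, hbR⟩
    · exact ⟨hca, hcR⟩
    · exact ⟨hxa, hxR⟩
  obtain ⟨w, hw1, hw2⟩ := h.meet haR (h.cl_sub hyR (Ne.symm hya)) hB
    (h.cl_card haR hyR (Ne.symm hya))
    (Finset.card_eq_three.2 ⟨b, c, x, hcb.symm, hxb.symm, hxc.symm, rfl⟩)
  simp only [Finset.mem_insert, Finset.mem_singleton] at hw2
  rcases Finset.mem_insert.1 hw1 with e | hw1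
  · subst e; tauto
  have hvy : v ≠ y := fun e => h.vR (e ▸ hyR)
  have hyw := Nb3_swap hvy (Ne.symm hya) hw1
  rcases hw2 with rfl | rfl | rfl
  · rcases eqpair a w c x haR hbR hba.symm hxc.symm
      (key a w c haR hbR hcR hba.symm hca.symm hcb.symm (sub _ _ _ rfl (by simp) (by simp)))
      (key a w x haR hbR hxR hba.symm hxa.symm hxb.symm (sub _ _ _ rfl (by simp) (by simp)))
      y hyw with e | e <;> tauto
  · rcases eqpair a w b x haR hcR hca.symm hxb.symm
      (key a w b haR hcR hbR hca.symm hba.symm hcb (sub _ _ _ rfl (by simp) (by simp)))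
      (key a w x haR hcR hxR hca.symm hxa.symm hxc.symm (sub _ _ _ rfl (by simp) (by simp)))
      y hyw with e | e <;> tauto
  · rcases eqpair a w b c haR hxR hxa.symm hcb.symm
      (key a w b haR hxR hbR hxa.symm hba.symm hxb (sub _ _ _ rfl (by simp) (by simp)))
      (key a w c haR hxR hcR hxa.symm hca.symm hxc (sub _ _ _ rfl (by simp) (by simp)))
      y hyw with e | e <;> tauto

end Surf

/-! ### Counting -/

/-- Faces of cardinality `k` through `v`. -/
def St (K : Finset (Finset V)) (v : V) (k : ℕ) : Finset (Finset V) :=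
  K.filter fun s => v ∈ s ∧ s.card = k

lemma mem_St {K : Finset (Finset V)} {v : V} {k : ℕ} {s : Finset V} :
    s ∈ St K v k ↔ s ∈ K ∧ v ∈ s ∧ s.card = k := by
  simp only [St, Finset.mem_filter]

lemma sum_St (K : Finset (Finset V)) (k : ℕ) :
    ∑ v ∈ verts K, (St K v (k + 1)).card = (k + 1) * fvec K k := by
  have h := Finset.sum_card_bipartiteAbove_eq_sum_card_bipartiteBelow
    (s := verts K) (t := K.filter fun s => s.card = k + 1) (fun (v : V) (s : Finset V) => v ∈ s)
  have h1 : ∀ v ∈ verts K, ((K.filter fun s => s.card = k + 1).bipartiteAbove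
      (fun (v : V) (s : Finset V) => v ∈ s) v).card = (St K v (k + 1)).card := by
    intro v _
    congr 1
    ext s
    simp only [Finset.mem_bipartiteAbove, Finset.mem_filter, mem_St]
    tauto
  have h2 : ∀ s ∈ K.filter (fun s => s.card = k + 1), ((verts K).bipartiteBelow
      (fun (v : V) (s : Finset V) => v ∈ s) s).card = k + 1 := by
    intro s hs
    obtain ⟨hs1, hs2⟩ := Finset.mem_filter.1 hs
    rw [← hs2]
    congr 1
    ext v
    simp only [Finset.mem_bipartiteBelow]
    exact ⟨fun h => h.2, fun h => ⟨subset_verts hs1 h, h⟩⟩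
  rw [Finset.sum_congr rfl h1, Finset.sum_congr rfl h2] at h
  rw [h, Finset.sum_const, smul_eq_mul, mul_comm, fvec]

lemma St_two (K : Finset (Finset V)) (v : V) : (St K v 2).card = (Nb K {v}).card := by
  symm
  refine Finset.card_bij (fun w _ => ({v, w} : Finset V)) ?_ ?_ ?_
  · intro w hw
    rw [mem_Nb1] at hw
    exact mem_St.2 ⟨hw.2, by simp, Finset.card_pair hw.1.symm⟩
  · intro a ha b hb h
    rw [mem_Nb1] at ha hb
    have : a ∈ ({v, b} : Finset V) := by rw [← h]; simp
    simp only [Finset.mem_insert, Finset.mem_singleton] at this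
    exact this.resolve_left ha.1
  · intro s hs
    obtain ⟨h1, h2, h3⟩ := mem_St.1 hs
    have h4 : (s.erase v).card = 1 := by rw [Finset.card_erase_of_mem h2, h3]
    obtain ⟨w, hw⟩ := Finset.card_eq_one.1 h4
    have hs' : s = {v, w} := by rw [← Finset.insert_erase h2, hw]
    have hwv : w ≠ v := by
      have : w ∈ s.erase v := by rw [hw]; simp
      exact (Finset.mem_erase.1 this).1
    exact ⟨w, mem_Nb1.2 ⟨hwv, hs' ▸ h1⟩, hs'.symm⟩

lemma erase_injOn (v : V) (A : Finset (Finset V)) (hA : ∀ s ∈ A, v ∈ s) :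
    Set.InjOn (fun s : Finset V => s.erase v) (A : Set (Finset V)) := by
  intro s hs t ht h
  have h' : s.erase v = t.erase v := h
  rw [← Finset.insert_erase (hA s hs), h', Finset.insert_erase (hA t ht)]

lemma St_three_sub {K : Finset (Finset V)} (hK : IsComplex K) (v : V) :
    (St K v 3).image (fun s => s.erase v) ⊆ Finset.powersetCard 2 (Nb K {v}) := by
  intro e he
  obtain ⟨s, hs, rfl⟩ := Finset.mem_image.1 he
  obtain ⟨h1, h2, h3⟩ := mem_St.1 hs
  rw [Finset.mem_powersetCard]
  refine ⟨?_, by rw [Finset.card_erase_of_mem h2, h3]⟩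
  intro w hw
  rw [Finset.mem_erase] at hw
  refine mem_Nb1.2 ⟨hw.1, hK.2.2 _ h1 _ ?_ (by simp)⟩
  intro z hz
  simp only [Finset.mem_insert, Finset.mem_singleton] at hz
  rcases hz with rfl | rfl
  · exact h2
  · exact hw.2

lemma St_three_image_card (K : Finset (Finset V)) (v : V) :
    ((St K v 3).image (fun s => s.erase v)).card = (St K v 3).card :=
  Finset.card_image_of_injOn (erase_injOn v _ (fun _ hs => (mem_St.1 hs).2.1))

lemma St_three_le {K : Finset (Finset V)} (hK : IsComplex K) (v : V) :
    (St K v 3).card ≤ (Nb K {v}).card.choose 2 := by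
  rw [← St_three_image_card, ← Finset.card_powersetCard]
  exact Finset.card_le_card (St_three_sub hK v)

lemma sum_Nb_le (K : Finset (Finset V)) (v : V) :
    ∑ s ∈ St K v 3, (Nb K s).card ≤ 3 * (St K v 4).card := by
  have h := Finset.sum_card_bipartiteAbove_eq_sum_card_bipartiteBelow
    (s := St K v 3) (t := St K v 4) (fun (s t : Finset V) => s ⊆ t)
  have h1 : ∑ s ∈ St K v 3, (Nb K s).card ≤ ∑ s ∈ St K v 3, ((St K v 4).bipartiteAbove
      (fun (s t : Finset V) => s ⊆ t) s).card := by
    apply Finset.sum_le_sum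
    intro s hs
    obtain ⟨hs1, hs2, hs3⟩ := mem_St.1 hs
    refine Finset.card_le_card_of_injOn (fun w => insert w s) ?_ ?_
    · intro w hw
      have hw' := mem_Nb.1 hw
      refine Finset.mem_coe.2 ?_
      rw [Finset.mem_bipartiteAbove, mem_St]
      refine ⟨⟨hw'.2, Finset.mem_insert_of_mem hs2, ?_⟩, Finset.subset_insert _ _⟩
      rw [Finset.card_insert_of_notMem hw'.1, hs3]
    · intro a ha b hb hab
      have ha' := mem_Nb.1 ha
      have : a ∈ insert b s := by
        have h' : insert a s = insert b s := hab
        rw [← h']; exact Finset.mem_insert_self _ _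
      exact (Finset.mem_insert.1 this).resolve_right ha'.1
  have h2 : ∑ t ∈ St K v 4, ((St K v 3).bipartiteBelow
      (fun (s t : Finset V) => s ⊆ t) t).card ≤ ∑ t ∈ St K v 4, 3 := by
    apply Finset.sum_le_sum
    intro t ht
    obtain ⟨ht1, ht2, ht3⟩ := mem_St.1 ht
    have h3 : (Finset.powersetCard 2 (t.erase v)).card = 3 := by
      rw [Finset.card_powersetCard, Finset.card_erase_of_mem ht2, ht3]; rfl
    refine le_trans (Finset.card_le_card_of_injOn
      (t := Finset.powersetCard 2 (t.erase v)) (fun s => s.erase v) ?_ ?_) h3.le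
    · intro s hs
      have hs' := (Finset.mem_bipartiteBelow _).1 (Finset.mem_coe.1 hs)
      obtain ⟨hs1, hs2, hs3⟩ := mem_St.1 hs'.1
      refine Finset.mem_coe.2 (Finset.mem_powersetCard.2
        ⟨Finset.erase_subset_erase _ hs'.2, ?_⟩)
      rw [Finset.card_erase_of_mem hs2, hs3]
    · exact erase_injOn v _
        (fun s hs => (mem_St.1 ((Finset.mem_bipartiteBelow _).1 hs).1).2.1)
  rw [Finset.sum_const, smul_eq_mul] at h2
  omega

lemma two_St_le {K : Finset (Finset V)} (hK : Good K) (v : V) :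
    2 * (St K v 3).card ≤ 3 * (St K v 4).card := by
  refine le_trans ?_ (sum_Nb_le K v)
  rw [mul_comm, ← smul_eq_mul, ← Finset.sum_const]
  apply Finset.sum_le_sum
  intro s hs
  obtain ⟨hs1, hs2, hs3⟩ := mem_St.1 hs
  exact hK.Nb3 hs1 hs3

lemma Nb1_le {K : Finset (Finset V)} (h7 : (verts K).card = 7) {v : V}
    (hv : v ∈ verts K) : (Nb K {v}).card ≤ 6 := by
  have hvN : v ∉ Nb K {v} := by
    intro h
    exact (mem_Nb1.1 h).1 rfl
  have := Finset.card_le_card (Good.closed_nb_sub hv)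
  rw [Finset.card_insert_of_notMem hvN, h7] at this
  omega

lemma surf_of_card {K : Finset (Finset V)} (hK : Good K) (h7 : (verts K).card = 7) {v : V}
    (hv : v ∈ verts K) (hd : (Nb K {v}).card = 6) (hp : (St K v 3).card = 15)
    (hq : (St K v 4).card = 10) : Surf K v (Nb K {v}) := by
  have hvN : v ∉ Nb K {v} := by
    intro h
    exact (mem_Nb1.1 h).1 rfl
  have htri : ∀ a ∈ Nb K {v}, ∀ b ∈ Nb K {v}, a ≠ b → ({v, a, b} : Finset V) ∈ K := by
    intro a ha b hb hab
    have hE : (St K v 3).image (fun s => s.erase v) = Finset.powersetCard 2 (Nb K {v}) := by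
      apply Finset.eq_of_subset_of_card_le (St_three_sub hK.cx v)
      rw [St_three_image_card, hp, Finset.card_powersetCard, hd]
      decide
    have : ({a, b} : Finset V) ∈ Finset.powersetCard 2 (Nb K {v}) := by
      rw [Finset.mem_powersetCard]
      refine ⟨?_, Finset.card_pair hab⟩
      intro z hz
      simp only [Finset.mem_insert, Finset.mem_singleton] at hz
      rcases hz with rfl | rfl <;> assumption
    rw [← hE] at this
    obtain ⟨s, hs, hse⟩ := Finset.mem_image.1 this
    obtain ⟨h1, h2, h3⟩ := mem_St.1 hs
    have hse' : s.erase v = {a, b} := hse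
    rw [← hse', Finset.insert_erase h2]
    exact h1
  refine ⟨hvN, hd, ?_, htri, ?_⟩
  · symm
    apply Finset.eq_of_subset_of_card_le (Good.closed_nb_sub hv)
    rw [Finset.card_insert_of_notMem hvN, hd, h7]
  · intro a ha b hb hab
    have hav := (mem_Nb1.1 ha).1
    have hbv := (mem_Nb1.1 hb).1
    have hmem : ({v, a, b} : Finset V) ∈ St K v 3 :=
      mem_St.2 ⟨htri a ha b hb hab, by simp,
        Finset.card_eq_three.2 ⟨v, a, b, hav.symm, hbv.symm, hab, rfl⟩⟩
    have hsum := sum_Nb_le K v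
    rw [hq, ← Finset.add_sum_erase _ _ hmem] at hsum
    have hrest : ∑ s ∈ (St K v 3).erase {v, a, b}, 2 ≤
        ∑ s ∈ (St K v 3).erase {v, a, b}, (Nb K s).card := by
      apply Finset.sum_le_sum
      intro s hs
      obtain ⟨hs1, hs2, hs3⟩ := mem_St.1 (Finset.mem_of_mem_erase hs)
      exact hK.Nb3 hs1 hs3
    rw [Finset.sum_const, smul_eq_mul, Finset.card_erase_of_mem hmem, hp] at hrest
    have hge := hK.Nb3 (mem_St.1 hmem).1 (mem_St.1 hmem).2.2
    omega

/-- The local inequality. -/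
lemma local_ineq {K : Finset (Finset V)} (hK : Good K) (h7 : (verts K).card = 7)
    (hac : Z2Acyclic K) {v : V} (hv : v ∈ verts K) :
    (St K v 3).card + 2 ≤ (St K v 2).card + (St K v 4).card := by
  rw [St_two]
  by_contra hcon
  have h1 := two_St_le hK v
  have h2 := St_three_le hK.cx v
  have h3 := hK.Nb1' hv
  have h4 := Nb1_le h7 hv
  have h5 : (Nb K {v}).card = 4 ∨ (Nb K {v}).card = 5 ∨ (Nb K {v}).card = 6 := by omega
  rcases h5 with h | h | h
  · rw [h] at h2 hcon
    have : Nat.choose 4 2 = 6 := by decide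
    omega
  · rw [h] at h2 hcon
    have : Nat.choose 5 2 = 10 := by decide
    omega
  · rw [h] at h2 hcon
    have : Nat.choose 6 2 = 15 := by decide
    exact (surf_of_card hK h7 hv h (by omega) (by omega)).contra hK hac

lemma global_ineq {K : Finset (Finset V)} (hK : Good K) (h7 : (verts K).card = 7)
    (hac : Z2Acyclic K) : 3 * fvec K 2 + 14 ≤ 2 * fvec K 1 + 4 * fvec K 3 := by
  have h : ∑ v ∈ verts K, ((St K v 3).card + 2) ≤
      ∑ v ∈ verts K, ((St K v 2).card + (St K v 4).card) :=
    Finset.sum_le_sum (fun v hv => local_ineq hK h7 hac hv)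
  rw [Finset.sum_add_distrib, Finset.sum_add_distrib, Finset.sum_const, h7] at h
  have e1 := sum_St K 1
  have e2 := sum_St K 2
  have e3 := sum_St K 3
  norm_num only at e1 e2 e3 h
  rw [e1, e2, e3] at h
  simpa using h

/-- Pairs (vertex, triple) where the vertex separates an edge and a non-edge. -/
def Mx (K : Finset (Finset V)) (v : V) : Finset (Finset V) :=
  (Finset.powersetCard 3 (verts K) \ K).filter fun t =>
    ∃ x y, t = {v, x, y} ∧ x ∈ Nb K {v} ∧ y ∉ Nb K {v} ∧ y ≠ v

lemma Mx_card {K : Finset (Finset V)} (hK : IsComplex K) {v : V} (hv : v ∈ verts K) :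
    (Nb K {v}).card * ((verts K).card - 1 - (Nb K {v}).card) ≤ (Mx K v).card := by
  have hvN : v ∉ Nb K {v} := by
    intro h
    exact (mem_Nb1.1 h).1 rfl
  have hcard : (((verts K).erase v) \ Nb K {v}).card =
      (verts K).card - 1 - (Nb K {v}).card := by
    rw [Finset.card_sdiff_of_subset, Finset.card_erase_of_mem hv]
    intro w hw
    exact Finset.mem_erase.2 ⟨(mem_Nb1.1 hw).1, Good.Nb_sub_verts _ hw⟩
  rw [← hcard, ← Finset.card_product]
  refine Finset.card_le_card_of_injOn (fun p => ({v, p.1, p.2} : Finset V)) ?_ ?_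
  · rintro ⟨x, y⟩ hp
    have hp' := Finset.mem_product.1 (Finset.mem_coe.1 hp)
    simp only [Finset.mem_sdiff, Finset.mem_erase] at hp'
    obtain ⟨hx, ⟨hyv, hyS⟩, hyN⟩ := hp'
    have hxv := (mem_Nb1.1 hx).1
    have hxy : x ≠ y := fun e => hyN (e ▸ hx)
    refine Finset.mem_coe.2 (Finset.mem_filter.2 ⟨Finset.mem_sdiff.2 ⟨?_, ?_⟩,
      x, y, rfl, hx, hyN, hyv⟩)
    · rw [Finset.mem_powersetCard]
      refine ⟨?_, Finset.card_eq_three.2 ⟨v, x, y, hxv.symm, hyv.symm, hxy, rfl⟩⟩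
      intro z hz
      simp only [Finset.mem_insert, Finset.mem_singleton] at hz
      rcases hz with rfl | rfl | rfl
      · exact hv
      · exact Good.Nb_sub_verts _ hx
      · exact hyS
    · intro hmem
      have hmem' : ({v, x, y} : Finset V) ∈ K := hmem
      apply hyN
      refine mem_Nb1.2 ⟨hyv, hK.2.2 _ hmem' _ ?_ (by simp)⟩
      intro z hz
      simp only [Finset.mem_insert, Finset.mem_singleton] at hz ⊢
      tauto
  · rintro ⟨x, y⟩ hp ⟨x', y'⟩ hp' h
    have h1 := Finset.mem_product.1 (Finset.mem_coe.1 hp)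
    have h2 := Finset.mem_product.1 (Finset.mem_coe.1 hp')
    simp only [Finset.mem_sdiff, Finset.mem_erase] at h1 h2
    obtain ⟨hx, ⟨hyv, hyS⟩, hyN⟩ := h1
    obtain ⟨hx', ⟨hyv', hyS'⟩, hyN'⟩ := h2
    have h' : ({v, x, y} : Finset V) = {v, x', y'} := h
    have a1 : x ∈ ({v, x', y'} : Finset V) := by rw [← h']; simp
    have a2 : y ∈ ({v, x', y'} : Finset V) := by rw [← h']; simp
    simp only [Finset.mem_insert, Finset.mem_singleton] at a1 a2
    have hxv := (mem_Nb1.1 hx).1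
    have b1 : x = x' := by
      rcases a1 with e | e | e
      · exact absurd e hxv
      · exact e
      · exact absurd (e ▸ hx) hyN'
    have b2 : y = y' := by
      rcases a2 with e | e | e
      · exact absurd e hyv
      · exact absurd (e ▸ hx') hyN
      · exact e
    rw [b1, b2]

lemma Mx_sub_edge {K : Finset (Finset V)} {v a b : V} (hva : v ≠ a) (hvb : v ≠ b)
    (h : ({v, a, b} : Finset V) ∈ Mx K v) : ¬ (a ∈ Nb K {v} ↔ b ∈ Nb K {v}) := by
  obtain ⟨-, x, y, hE, hx, hy, hyv⟩ := Finset.mem_filter.1 h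
  have hxv := (mem_Nb1.1 hx).1
  have a1 : x ∈ ({v, a, b} : Finset V) := by rw [hE]; simp
  have a2 : y ∈ ({v, a, b} : Finset V) := by rw [hE]; simp
  simp only [Finset.mem_insert, Finset.mem_singleton] at a1 a2
  have hxy : x ≠ y := fun e => hy (e ▸ hx)
  rcases a1 with e | e | e
  · exact absurd e hxv
  · rcases a2 with e' | e' | e'
    · exact absurd e' hyv
    · exact absurd (e.trans e'.symm) hxy
    · subst e; subst e'; tauto
  · rcases a2 with e' | e' | e'
    · exact absurd e' hyv
    · subst e; subst e'; tauto
    · exact absurd (e.trans e'.symm) hxy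

lemma no_three {p q r : Prop} (h1 : ¬ (p ↔ q)) (h2 : ¬ (p ↔ r)) (h3 : ¬ (q ↔ r)) : False := by
  by_cases p <;> by_cases q <;> by_cases r <;> simp_all

lemma goodman {K : Finset (Finset V)} (h7 : (verts K).card = 7) :
    ∑ v ∈ verts K, (Mx K v).card ≤ 2 * (35 - fvec K 2) := by
  set N := Finset.powersetCard 3 (verts K) \ K with hN
  have hNc : N.card = 35 - fvec K 2 := by
    have e : Finset.powersetCard 3 (verts K) \ K =
        Finset.powersetCard 3 (verts K) \ (K.filter fun s => s.card = 2 + 1) := by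
      ext s
      simp only [Finset.mem_sdiff, Finset.mem_powersetCard, Finset.mem_filter]
      tauto
    rw [hN, e, Finset.card_sdiff_of_subset, Finset.card_powersetCard, h7, fvec]
    · rfl
    · intro s hs
      obtain ⟨h1, h2⟩ := Finset.mem_filter.1 hs
      exact Finset.mem_powersetCard.2 ⟨subset_verts h1, h2⟩
  have h := Finset.sum_card_bipartiteAbove_eq_sum_card_bipartiteBelow
    (s := verts K) (t := N) (fun (v : V) (t : Finset V) => t ∈ Mx K v)
  have h1 : ∀ v ∈ verts K, (N.bipartiteAbove
      (fun (v : V) (t : Finset V) => t ∈ Mx K v) v).card = (Mx K v).card := by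
    intro v _
    congr 1
    ext t
    simp only [Finset.mem_bipartiteAbove]
    exact ⟨fun h => h.2, fun h => ⟨(Finset.mem_filter.1 h).1, h⟩⟩
  have h2 : ∀ t ∈ N, ((verts K).bipartiteBelow
      (fun (v : V) (t : Finset V) => t ∈ Mx K v) t).card ≤ 2 := by
    intro t ht
    have ht3 := (Finset.mem_powersetCard.1 (Finset.mem_sdiff.1 ht).1).2
    have hsub : (verts K).bipartiteBelow
        (fun (v : V) (t : Finset V) => t ∈ Mx K v) t ⊆ t := by
      intro v hv
      obtain ⟨-, x, y, hE, -⟩ := Finset.mem_filter.1 ((Finset.mem_bipartiteBelow _).1 hv).2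
      rw [hE]; simp
    by_contra hcon
    have heq := Finset.eq_of_subset_of_card_le hsub (by omega)
    have hall : ∀ v ∈ t, t ∈ Mx K v := by
      intro v hv
      rw [← heq] at hv
      exact ((Finset.mem_bipartiteBelow _).1 hv).2
    obtain ⟨a, b, c, hab, hac, hbc, rfl⟩ := Finset.card_eq_three.1 ht3
    have ma := Mx_sub_edge hab hac (hall a (by simp))
    have eb : ({a, b, c} : Finset V) = {b, a, c} := Finset.insert_comm _ _ _
    have mb := hall b (by simp)
    rw [eb] at mb
    have mb := Mx_sub_edge hab.symm hbc mb
    have ec : ({a, b, c} : Finset V) = {c, a, b} := by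
      ext x; simp only [Finset.mem_insert, Finset.mem_singleton]; tauto
    have mc := hall c (by simp)
    rw [ec] at mc
    have mc := Mx_sub_edge hac.symm hbc.symm mc
    have s1 : a ∈ Nb K {b} ↔ b ∈ Nb K {a} := ⟨Nb1_symm, Nb1_symm⟩
    have s2 : a ∈ Nb K {c} ↔ c ∈ Nb K {a} := ⟨Nb1_symm, Nb1_symm⟩
    have s3 : b ∈ Nb K {c} ↔ c ∈ Nb K {b} := ⟨Nb1_symm, Nb1_symm⟩
    rw [s1] at mb
    rw [s2, s3] at mc
    exact no_three ma mb mc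
  rw [Finset.sum_congr rfl h1] at h
  rw [h, ← hNc, mul_comm]
  exact Finset.sum_le_card_nsmul _ _ _ h2

lemma fvec_le {K : Finset (Finset V)} (h7 : (verts K).card = 7) (k : ℕ) :
    fvec K k ≤ Nat.choose 7 (k + 1) := by
  rw [← h7, ← Finset.card_powersetCard, fvec]
  apply Finset.card_le_card
  intro s hs
  obtain ⟨h1, h2⟩ := Finset.mem_filter.1 hs
  exact Finset.mem_powersetCard.2 ⟨subset_verts h1, h2⟩

lemma edges_avoid {K : Finset (Finset V)} (h7 : (verts K).card = 7) {v : V}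
    (hv : v ∈ verts K) : fvec K 1 ≤ 15 + (St K v 2).card := by
  have h1 : (K.filter fun s => s.card = 1 + 1) ⊆
      Finset.powersetCard 2 ((verts K).erase v) ∪ St K v 2 := by
    intro s hs
    obtain ⟨h1, h2⟩ := Finset.mem_filter.1 hs
    rw [Finset.mem_union]
    by_cases hvs : v ∈ s
    · exact Or.inr (mem_St.2 ⟨h1, hvs, h2⟩)
    · refine Or.inl (Finset.mem_powersetCard.2 ⟨?_, h2⟩)
      intro w hw
      exact Finset.mem_erase.2 ⟨fun e => hvs (e ▸ hw), subset_verts h1 hw⟩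
  have h2 := (Finset.card_le_card h1).trans (Finset.card_union_le _ _)
  rw [Finset.card_powersetCard, Finset.card_erase_of_mem hv, h7] at h2
  have : Nat.choose (7 - 1) 2 = 15 := by decide
  rw [this] at h2
  exact h2

/-- The upper bound for the number of triangles, given a lower bound for the degrees. -/
lemma upper {K : Finset (Finset V)} (hK : Good K) (h7 : (verts K).card = 7) (m : ℕ)
    (hm : ∀ v ∈ verts K, m ≤ (Nb K {v}).card) :
    m * 42 + 2 * fvec K 2 ≤ m * (2 * fvec K 1) + 70 := by
  have h := goodman h7
  have h2 := fvec_le h7 2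
  have e : Nat.choose 7 (2 + 1) = 35 := by decide
  rw [e] at h2
  have e1 := sum_St K 1
  norm_num only at e1
  have hv : ∀ v ∈ verts K, m * 6 ≤ (Mx K v).card + m * (St K v 2).card := by
    intro v hv
    have a1 := Mx_card hK.cx hv
    have a2 := Nb1_le h7 hv
    have a3 := hm v hv
    rw [h7] at a1
    rw [St_two]
    obtain ⟨k, hk⟩ := Nat.exists_eq_add_of_le a2
    have hk' : 7 - 1 - (Nb K {v}).card = k := by omega
    rw [hk'] at a1
    calc m * 6 = m * (Nb K {v}).card + m * k := by rw [hk, mul_add]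
      _ ≤ m * (Nb K {v}).card + (Nb K {v}).card * k := by gcongr
      _ ≤ _ := by omega
  have hs := Finset.sum_le_sum hv
  rw [Finset.sum_const, Finset.sum_add_distrib, ← Finset.mul_sum, h7, e1, smul_eq_mul] at hs
  have : 7 * (m * 6) = m * 42 := by ring
  omega

/-- Lemma 3.4: a 7-vertex 3-dimensional `ℤ/2`-acyclic
non-collapsible simplicial complex which is minimal with these properties has
f-vector `(7,20,30,16)`, `(7,21,32,17)`, `(7,21,33,18)`, `(7,21,34,19)` or
`(7,21,35,20)`. -/
theorem minimal_three_dim_f_vector {V : Type*} [DecidableEq V]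
    (X : Finset (Finset V)) (hX : IsComplex X) (h7 : (verts X).card = 7)
    (hdim : X.sup Finset.card = 4)
    (hac : Z2Acyclic X) (hnc : ¬ Collapsible X)
    (hmin : ∀ Y : Finset (Finset V), Y ⊆ X → Y ≠ X → IsComplex Y →
      ¬ (Z2Acyclic Y ∧ ¬ Collapsible Y)) :
    (fvec X 0 = 7 ∧ fvec X 1 = 20 ∧ fvec X 2 = 30 ∧ fvec X 3 = 16) ∨
    (fvec X 0 = 7 ∧ fvec X 1 = 21 ∧ fvec X 2 = 32 ∧ fvec X 3 = 17) ∨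
    (fvec X 0 = 7 ∧ fvec X 1 = 21 ∧ fvec X 2 = 33 ∧ fvec X 3 = 18) ∨
    (fvec X 0 = 7 ∧ fvec X 1 = 21 ∧ fvec X 2 = 34 ∧ fvec X 3 = 19) ∨
    (fvec X 0 = 7 ∧ fvec X 1 = 21 ∧ fvec X 2 = 35 ∧ fvec X 3 = 20) := by
  have hK := minimal_good hX h7 hdim hac hnc hmin
  have hle : ∀ s ∈ X, s.card ≤ 4 := by
    intro s hs
    rw [← hdim]
    exact Finset.le_sup (f := Finset.card) hs
  have hE := euler hX hac hle
  have h0 := fvec_zero hK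
  rw [h7] at h0
  have hG := global_ineq hK h7 hac
  have h1 := fvec_le h7 1
  have e1 : Nat.choose 7 (1 + 1) = 21 := by decide
  have h2 := fvec_le h7 2
  have e2 : Nat.choose 7 (2 + 1) = 35 := by decide
  rw [e1] at h1
  rw [e2] at h2
  have hU := upper hK h7 4 (fun v hv => hK.Nb1' hv)
  have hf1 : fvec X 1 = 20 ∨ fvec X 1 = 21 := by omega
  rcases hf1 with h | h
  · have hU5 := upper hK h7 5 (by
      intro v hv
      have := edges_avoid h7 hv
      rw [St_two] at this
      omega)
    omega
  · omega

end HomologySpheres
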